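/- arXiv:1405.2581 — 4 statements merged into one kernel-verified Lean document; each statement's English description precedes it below -/
import Mathlib

section
/- Let n ≥ 1, R > 0, let μ be a probability measure on ℝⁿ supported in the closed ball of radius R centered at 0, and let 0 < δ ≤ R². Then the convolution μ_δ = μ * γ_δ satisfies a Poincaré inequality with constant C_P ≤ (8 + 144/(e π²)) · R² · exp(17n + 25R²/(8δ)): for every smooth compactly supported g : ℝⁿ → ℝ with ∫ g dμ_δ = 0, one has ∫ g² dμ_δ ≤ C_P ∫ |∇g|² dμ_δ. -/
open MeasureTheory Real

/-- Centered Gaussian measure on ℝⁿ of variance δ. -/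
noncomputable def gaussianRn (n : ℕ) (δ : ℝ) : Measure (EuclideanSpace ℝ (Fin n)) :=
  volume.withDensity fun x =>
    ENNReal.ofReal ((2 * π * δ) ^ (-(n : ℝ) / 2) * Real.exp (-‖x‖ ^ 2 / (2 * δ)))

/-- Convolution of two measures on ℝⁿ. -/
noncomputable def mconvn {n : ℕ} (μ ν : Measure (EuclideanSpace ℝ (Fin n))) :
    Measure (EuclideanSpace ℝ (Fin n)) :=
  (μ.prod ν).map fun p => p.1 + p.2

/-- Entropy functional Ent_ν(g) = ∫ g log (g / ∫ g dν) dν. -/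
noncomputable def Ent {α : Type*} [MeasurableSpace α] (ν : Measure α) (g : α → ℝ) : ℝ :=
  ∫ x, g x * Real.log (g x / ∫ y, g y ∂ν) ∂ν

/-- ν satisfies a logarithmic Sobolev inequality on ℝⁿ with constant c:
Ent_ν(f²) ≤ c ∫ |∇f|² dν for all smooth compactly supported f : ℝⁿ → ℝ. -/
def SatisfiesLSIn {n : ℕ} (ν : Measure (EuclideanSpace ℝ (Fin n))) (c : ℝ) : Prop :=
  ∀ f : EuclideanSpace ℝ (Fin n) → ℝ, ContDiff ℝ (⊤ : ℕ∞) f → HasCompactSupport f →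
    Ent ν (fun x => f x ^ 2) ≤ c * ∫ x, ‖gradient f x‖ ^ 2 ∂ν

/-- The density of `gaussianRn n δ`. -/
noncomputable def gaussianRnDensity (n : ℕ) (δ : ℝ) (x : EuclideanSpace ℝ (Fin n)) : ℝ :=
  (2 * π * δ) ^ (-(n : ℝ) / 2) * Real.exp (-‖x‖ ^ 2 / (2 * δ))

lemma gaussianRn_eq (n : ℕ) (δ : ℝ) :
    gaussianRn n δ = volume.withDensity fun x => ENNReal.ofReal (gaussianRnDensity n δ x) := rfl

@[fun_prop]
lemma continuous_gaussianRnDensity (n : ℕ) (δ : ℝ) : Continuous (gaussianRnDensity n δ) := by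
  unfold gaussianRnDensity
  fun_prop

lemma gaussianRnDensity_nonneg (n : ℕ) {δ : ℝ} (hδ : 0 < δ) (x : EuclideanSpace ℝ (Fin n)) :
    0 ≤ gaussianRnDensity n δ x := by
  unfold gaussianRnDensity
  positivity

lemma lintegral_gaussianRn (n : ℕ) (δ : ℝ) {F : EuclideanSpace ℝ (Fin n) → ENNReal}
    (hF : Measurable F) :
    ∫⁻ x, F x ∂(gaussianRn n δ) = ∫⁻ x, ENNReal.ofReal (gaussianRnDensity n δ x) * F x := by
  rw [gaussianRn_eq, lintegral_withDensity_eq_lintegral_mul _ (by fun_prop) hF]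
  rfl

lemma lintegral_exp_neg_mul_sq_norm (n : ℕ) {b : ℝ} (hb : 0 < b) :
    ∫⁻ x : EuclideanSpace ℝ (Fin n), ENNReal.ofReal (Real.exp (-b * ‖x‖ ^ 2)) =
      ENNReal.ofReal ((π / b) ^ ((n : ℝ) / 2)) := by
  have h := GaussianFourier.integral_rexp_neg_mul_sq_norm (V := EuclideanSpace ℝ (Fin n)) hb
  rw [finrank_euclideanSpace_fin] at h
  rw [← h, ofReal_integral_eq_lintegral_ofReal]
  · refine Integrable.of_integral_ne_zero ?_
    rw [h]
    positivity
  · exact Filter.Eventually.of_forall fun _ => by positivity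

lemma isProbabilityMeasure_gaussianRn (n : ℕ) {δ : ℝ} (hδ : 0 < δ) :
    IsProbabilityMeasure (gaussianRn n δ) := by
  constructor
  rw [← lintegral_one, lintegral_gaussianRn n δ measurable_const]
  have h (x : EuclideanSpace ℝ (Fin n)) : ENNReal.ofReal (gaussianRnDensity n δ x) * 1 =
      ENNReal.ofReal ((2 * π * δ) ^ (-(n : ℝ) / 2)) *
        ENNReal.ofReal (Real.exp (-(1 / (2 * δ)) * ‖x‖ ^ 2)) := by
    rw [mul_one, ← ENNReal.ofReal_mul (by positivity), gaussianRnDensity]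
    congr 3
    ring
  simp_rw [h]
  rw [lintegral_const_mul _ (by fun_prop), lintegral_exp_neg_mul_sq_norm n (by positivity),
    ← ENNReal.ofReal_mul (by positivity), show π / (1 / (2 * δ)) = 2 * π * δ by field_simp,
    ← Real.rpow_add (by positivity)]
  simp [neg_div]

lemma lintegral_sq_norm_gaussianRn_le (n : ℕ) {δ : ℝ} (hδ : 0 < δ) :
    ∫⁻ x, ‖x‖ₑ ^ 2 ∂(gaussianRn n δ) ≤ ENNReal.ofReal (4 * δ * 2 ^ ((n : ℝ) / 2)) := by
  rw [lintegral_gaussianRn n δ (by fun_prop)]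
  have h (x : EuclideanSpace ℝ (Fin n)) : ENNReal.ofReal (gaussianRnDensity n δ x) * ‖x‖ₑ ^ 2 ≤
      ENNReal.ofReal ((2 * π * δ) ^ (-(n : ℝ) / 2) * (4 * δ)) *
        ENNReal.ofReal (Real.exp (-(1 / (4 * δ)) * ‖x‖ ^ 2)) := by
    rw [← ofReal_norm, ← ENNReal.ofReal_pow (norm_nonneg _),
      ← ENNReal.ofReal_mul (gaussianRnDensity_nonneg n hδ x),
      ← ENNReal.ofReal_mul (by positivity)]
    apply ENNReal.ofReal_le_ofReal
    have h1 : ‖x‖ ^ 2 / (4 * δ) ≤ Real.exp (‖x‖ ^ 2 / (4 * δ)) :=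
      (by linarith : _ ≤ ‖x‖ ^ 2 / (4 * δ) + 1).trans (Real.add_one_le_exp _)
    rw [div_le_iff₀ (by positivity)] at h1
    have h2 : Real.exp (-(1 / (4 * δ)) * ‖x‖ ^ 2) =
        Real.exp (-‖x‖ ^ 2 / (2 * δ)) * Real.exp (‖x‖ ^ 2 / (4 * δ)) := by
      rw [← Real.exp_add]
      congr 1
      field_simp
      ring
    rw [h2, gaussianRnDensity]
    calc _ ≤ (2 * π * δ) ^ (-(n : ℝ) / 2) * Real.exp (-‖x‖ ^ 2 / (2 * δ)) *
          (Real.exp (‖x‖ ^ 2 / (4 * δ)) * (4 * δ)) := by gcongr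
      _ = _ := by ring
  refine (lintegral_mono h).trans_eq ?_
  rw [lintegral_const_mul _ (by fun_prop), lintegral_exp_neg_mul_sq_norm n (by positivity),
    ← ENNReal.ofReal_mul (by positivity),
    show π / (1 / (4 * δ)) = 2 * (2 * π * δ) by field_simp; ring,
    Real.mul_rpow (x := 2) (y := 2 * π * δ) (by positivity) (by positivity)]
  congr 1
  rw [neg_div, Real.rpow_neg (by positivity)]
  have : (2 * π * δ) ^ ((n : ℝ) / 2) ≠ 0 := by positivity
  generalize (2 * π * δ) ^ ((n : ℝ) / 2) = A at this ⊢
  field_simp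

lemma sq_lintegral_mul_le {α : Type*} [MeasurableSpace α] (ν : Measure α) {f g : α → ENNReal}
    (hf : AEMeasurable f ν) (hg : AEMeasurable g ν) :
    (∫⁻ a, f a * g a ∂ν) ^ 2 ≤ (∫⁻ a, f a ^ 2 ∂ν) * ∫⁻ a, g a ^ 2 ∂ν := by
  have h := ENNReal.lintegral_mul_le_Lp_mul_Lq ν Real.HolderConjugate.two_two hf hg
  simp only [Pi.mul_apply, ENNReal.rpow_two] at h
  calc _ ≤ ((∫⁻ a, f a ^ 2 ∂ν) ^ (1 / 2 : ℝ) * (∫⁻ a, g a ^ 2 ∂ν) ^ (1 / 2 : ℝ)) ^ 2 := by gcongr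
    _ = _ := by
      rw [mul_pow, ← ENNReal.rpow_mul_natCast, ← ENNReal.rpow_mul_natCast]
      norm_num

/-- A Gaussian is comparable in `L²` with its translates. -/
lemma sq_lintegral_gaussianRn_le_translate (n : ℕ) {δ : ℝ} (hδ : 0 < δ)
    (y : EuclideanSpace ℝ (Fin n)) {F : EuclideanSpace ℝ (Fin n) → ENNReal} (hF : Measurable F) :
    (∫⁻ x, F x ∂(gaussianRn n δ)) ^ 2 ≤
      ENNReal.ofReal (Real.exp (‖y‖ ^ 2 / δ)) * ∫⁻ x, F (y + x) ^ 2 ∂(gaussianRn n δ) := by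
  set ρ : EuclideanSpace ℝ (Fin n) → ℝ :=
    fun x => Real.exp (-inner ℝ x y / δ - ‖y‖ ^ 2 / (2 * δ)) with hρ
  have hρc : Continuous ρ := by fun_prop
  have hnorm (x : EuclideanSpace ℝ (Fin n)) :
      ‖y + x‖ ^ 2 = ‖x‖ ^ 2 + 2 * inner ℝ x y + ‖y‖ ^ 2 := by
    rw [add_comm, norm_add_sq_real]
  have hnorm2 (x : EuclideanSpace ℝ (Fin n)) :
      ‖(2 : ℝ) • y + x‖ ^ 2 = ‖x‖ ^ 2 + 4 * inner ℝ x y + 4 * ‖y‖ ^ 2 := by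
    rw [add_comm, norm_add_sq_real, inner_smul_right, norm_smul]
    norm_num
    ring
  have h1 (x : EuclideanSpace ℝ (Fin n)) :
      gaussianRnDensity n δ (y + x) = gaussianRnDensity n δ x * ρ x := by
    simp only [gaussianRnDensity, hρ, hnorm]
    rw [mul_assoc _ (Real.exp _) (Real.exp _), ← Real.exp_add]
    congr 2
    field_simp
    ring
  have h2 (x : EuclideanSpace ℝ (Fin n)) : gaussianRnDensity n δ x * ρ x ^ 2 =
      Real.exp (‖y‖ ^ 2 / δ) * gaussianRnDensity n δ ((2 : ℝ) • y + x) := by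
    simp only [gaussianRnDensity, hρ, hnorm2]
    rw [mul_assoc _ (Real.exp _), ← Real.exp_nat_mul, ← Real.exp_add, mul_left_comm, ← Real.exp_add]
    congr 2
    field_simp
    push_cast
    ring
  have h3 : ∫⁻ x, F x ∂(gaussianRn n δ) =
      ∫⁻ x, F (y + x) * ENNReal.ofReal (ρ x) ∂(gaussianRn n δ) := by
    rw [lintegral_gaussianRn n δ hF, lintegral_gaussianRn n δ (by fun_prop),
      ← lintegral_add_left_eq_self _ y]
    refine lintegral_congr fun x => ?_
    rw [h1, ENNReal.ofReal_mul (gaussianRnDensity_nonneg n hδ x)]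
    ring
  have h4 : ∫⁻ x, ENNReal.ofReal (ρ x) ^ 2 ∂(gaussianRn n δ) =
      ENNReal.ofReal (Real.exp (‖y‖ ^ 2 / δ)) := by
    have := isProbabilityMeasure_gaussianRn n hδ
    rw [lintegral_gaussianRn n δ (by fun_prop)]
    have (x : EuclideanSpace ℝ (Fin n)) :
        ENNReal.ofReal (gaussianRnDensity n δ x) * ENNReal.ofReal (ρ x) ^ 2 =
        ENNReal.ofReal (Real.exp (‖y‖ ^ 2 / δ)) *
          ENNReal.ofReal (gaussianRnDensity n δ ((2 : ℝ) • y + x)) := by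
      rw [← ENNReal.ofReal_pow (by positivity),
        ← ENNReal.ofReal_mul (gaussianRnDensity_nonneg n hδ x), h2,
        ENNReal.ofReal_mul (by positivity)]
    simp_rw [this]
    rw [lintegral_const_mul _ (by fun_prop),
      lintegral_add_left_eq_self (fun x => ENNReal.ofReal (gaussianRnDensity n δ x))]
    have h5 := lintegral_gaussianRn n δ (F := fun _ => 1) measurable_const
    simp only [lintegral_one, measure_univ, mul_one] at h5
    rw [← h5, mul_one]
  rw [h3, ← h4, mul_comm]
  exact sq_lintegral_mul_le _ (by fun_prop) (by fun_prop)

lemma norm_sq_rotation_add {E : Type*} [NormedAddCommGroup E] [InnerProductSpace ℝ E]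
    (θ : ℝ) (p : E × E) :
    ‖(ContinuousLinearMap.rotation θ p).1‖ ^ 2 + ‖(ContinuousLinearMap.rotation θ p).2‖ ^ 2 =
      ‖p.1‖ ^ 2 + ‖p.2‖ ^ 2 := by
  simp only [ContinuousLinearMap.rotation_apply, norm_add_sq_real, real_inner_smul_left,
    real_inner_smul_right, norm_smul, mul_pow, norm_neg, Real.norm_eq_abs, sq_abs]
  linear_combination (‖p.1‖ ^ 2 + ‖p.2‖ ^ 2) * Real.sin_sq_add_cos_sq θ

lemma measurePreserving_rotation_volume (n : ℕ) (θ : ℝ) :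
    MeasurePreserving
      (ContinuousLinearMap.rotation (E := EuclideanSpace ℝ (Fin n)) θ) := by
  set E := EuclideanSpace ℝ (Fin n)
  let L : WithLp 2 (E × E) →ₗᵢ[ℝ] WithLp 2 (E × E) :=
    { toLinearMap := (WithLp.linearEquiv 2 ℝ (E × E)).symm.toLinearMap ∘ₗ
        (ContinuousLinearMap.rotation (E := E) θ).toLinearMap ∘ₗ
          (WithLp.linearEquiv 2 ℝ (E × E)).toLinearMap
      norm_map' := fun x => by
        rw [← sq_eq_sq₀ (norm_nonneg _) (norm_nonneg _), WithLp.prod_norm_sq_eq_of_L2,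
          WithLp.prod_norm_sq_eq_of_L2]
        exact norm_sq_rotation_add θ x.ofLp }
  have hL := (L.toLinearIsometryEquiv rfl).measurePreserving
  exact ((WithLp.volume_preserving_ofLp E E).comp hL).comp (WithLp.volume_preserving_toLp E E)

lemma measurePreserving_rotation_gaussianRn (n : ℕ) {δ : ℝ} (hδ : 0 < δ) (θ : ℝ) :
    MeasurePreserving
      (ContinuousLinearMap.rotation (E := EuclideanSpace ℝ (Fin n)) θ)
      ((gaussianRn n δ).prod (gaussianRn n δ)) ((gaussianRn n δ).prod (gaussianRn n δ)) := by
  refine ⟨by fun_prop, ?_⟩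
  set T := ContinuousLinearMap.rotation (E := EuclideanSpace ℝ (Fin n)) θ with hT
  set w : EuclideanSpace ℝ (Fin n) × EuclideanSpace ℝ (Fin n) → ENNReal := fun z =>
    ENNReal.ofReal (gaussianRnDensity n δ z.1) * ENNReal.ofReal (gaussianRnDensity n δ z.2) with hw
  have hprod : (gaussianRn n δ).prod (gaussianRn n δ) = volume.withDensity w := by
    rw [gaussianRn_eq, prod_withDensity (by fun_prop) (by fun_prop)]
    rfl
  have hwm : Measurable w := by fun_prop
  have hwT (z) : w (T z) = w z := by
    simp only [hw, hT,
      ← ENNReal.ofReal_mul (gaussianRnDensity_nonneg n hδ _)]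
    congr 1
    simp only [gaussianRnDensity]
    rw [mul_mul_mul_comm, ← Real.exp_add, mul_mul_mul_comm, ← Real.exp_add]
    congr 2
    rw [← add_div, ← add_div]
    congr 1
    linear_combination -norm_sq_rotation_add θ z
  rw [hprod]
  ext s hs
  rw [Measure.map_apply (by fun_prop) hs, withDensity_apply _ (T.continuous.measurable hs),
    withDensity_apply _ hs, ← (measurePreserving_rotation_volume n θ).setLIntegral_comp_preimage hs hwm]
  exact lintegral_congr fun z => (hwT z).symm

lemma sq_enorm_sub_le_lintegral_rotation {n : ℕ} {g : EuclideanSpace ℝ (Fin n) → ℝ}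
    (hg : ContDiff ℝ (⊤ : ℕ∞) g) (p : EuclideanSpace ℝ (Fin n) × EuclideanSpace ℝ (Fin n)) :
    ‖g p.2 - g p.1‖ₑ ^ 2 ≤ ENNReal.ofReal (π / 2) *
      ∫⁻ θ in Set.Ioc 0 (π / 2), ‖fderiv ℝ g (ContinuousLinearMap.rotation θ p).1‖ₑ ^ 2 *
        ‖(ContinuousLinearMap.rotation θ p).2‖ₑ ^ 2 := by
  have hfd : Continuous (fderiv ℝ g) := hg.continuous_fderiv (by simp)
  set f' : ℝ → ℝ := fun θ => fderiv ℝ g (ContinuousLinearMap.rotation θ p).1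
    (ContinuousLinearMap.rotation θ p).2 with hf'
  have hcont : Continuous f' := by
    simp only [hf', ContinuousLinearMap.rotation_apply]
    fun_prop
  have hderiv (θ : ℝ) : HasDerivAt (fun t => g (Real.cos t • p.1 + Real.sin t • p.2)) (f' θ) θ := by
    have h1 : HasDerivAt (fun t => Real.cos t • p.1 + Real.sin t • p.2)
        (-Real.sin θ • p.1 + Real.cos θ • p.2) θ :=
      ((Real.hasDerivAt_cos θ).smul_const _).add ((Real.hasDerivAt_sin θ).smul_const _)
    exact ((hg.differentiable (by simp)).differentiableAt.hasFDerivAt).comp_hasDerivAt θ h1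
  have hint := intervalIntegral.integral_eq_sub_of_hasDerivAt (a := 0) (b := π / 2)
    (fun θ _ => hderiv θ) (hcont.intervalIntegrable _ _)
  simp only [Real.cos_pi_div_two, Real.sin_pi_div_two, Real.cos_zero, Real.sin_zero, zero_smul,
    one_smul, zero_add, add_zero] at hint
  rw [intervalIntegral.integral_of_le (by positivity)] at hint
  calc ‖g p.2 - g p.1‖ₑ ^ 2 ≤ (∫⁻ θ in Set.Ioc 0 (π / 2), 1 * ‖f' θ‖ₑ) ^ 2 := by
        rw [← hint]
        simp only [one_mul]
        gcongr
        exact enorm_integral_le_lintegral_enorm _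
    _ ≤ (∫⁻ _θ in Set.Ioc 0 (π / 2), 1 ^ 2) * ∫⁻ θ in Set.Ioc 0 (π / 2), ‖f' θ‖ₑ ^ 2 :=
        sq_lintegral_mul_le _ (by fun_prop) (by fun_prop)
    _ ≤ _ := by
        simp only [one_pow, lintegral_one, Measure.restrict_apply_univ, Real.volume_Ioc, sub_zero]
        gcongr with θ
        rw [← mul_pow]
        gcongr
        exact ContinuousLinearMap.le_opENorm _ _

/-- A Poincaré-type inequality for two independent copies of a Gaussian. -/
lemma lintegral_sq_enorm_sub_gaussianRn_le {n : ℕ} {δ : ℝ} (hδ : 0 < δ)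
    {g : EuclideanSpace ℝ (Fin n) → ℝ} (hg : ContDiff ℝ (⊤ : ℕ∞) g) :
    ∫⁻ x, ∫⁻ z, ‖g z - g x‖ₑ ^ 2 ∂(gaussianRn n δ) ∂(gaussianRn n δ) ≤
      ENNReal.ofReal (π ^ 2 * δ * 2 ^ ((n : ℝ) / 2)) *
        ∫⁻ x, ‖fderiv ℝ g x‖ₑ ^ 2 ∂(gaussianRn n δ) := by
  have := isProbabilityMeasure_gaussianRn n hδ
  set γ := gaussianRn n δ
  have hfd : Continuous (fderiv ℝ g) := hg.continuous_fderiv (by simp)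
  have hgc : Continuous g := hg.continuous
  set G : EuclideanSpace ℝ (Fin n) × EuclideanSpace ℝ (Fin n) → ENNReal :=
    fun p => ‖fderiv ℝ g p.1‖ₑ ^ 2 * ‖p.2‖ₑ ^ 2
  have hGm : Measurable G := by
    have : Continuous fun p : EuclideanSpace ℝ (Fin n) × EuclideanSpace ℝ (Fin n) =>
      fderiv ℝ g p.1 := by fun_prop
    have := this.enorm.measurable
    fun_prop
  have hprod : ∫⁻ p, G p ∂(γ.prod γ) =
      (∫⁻ x, ‖fderiv ℝ g x‖ₑ ^ 2 ∂γ) * ∫⁻ x, ‖x‖ₑ ^ 2 ∂γ :=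
    lintegral_prod_mul (hfd.enorm.measurable.pow_const 2).aemeasurable
      (measurable_enorm.pow_const 2).aemeasurable
  have hsub : Measurable fun p : EuclideanSpace ℝ (Fin n) × EuclideanSpace ℝ (Fin n) =>
      ‖g p.2 - g p.1‖ₑ ^ 2 := by fun_prop
  rw [← lintegral_prod _ hsub.aemeasurable]
  calc _ ≤ ∫⁻ p, ENNReal.ofReal (π / 2) * (∫⁻ θ in Set.Ioc 0 (π / 2),
          G (ContinuousLinearMap.rotation θ p)) ∂(γ.prod γ) :=
        lintegral_mono fun p => sq_enorm_sub_le_lintegral_rotation hg p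
    _ = ENNReal.ofReal (π / 2) * ∫⁻ θ in Set.Ioc 0 (π / 2), (∫⁻ p,
          G (ContinuousLinearMap.rotation θ p) ∂(γ.prod γ)) := by
        have hm : Measurable (fun q : (EuclideanSpace ℝ (Fin n) × EuclideanSpace ℝ (Fin n)) × ℝ =>
            G (ContinuousLinearMap.rotation q.2 q.1)) := by
          refine hGm.comp (Continuous.measurable ?_)
          simp only [ContinuousLinearMap.rotation_apply]
          fun_prop
        rw [lintegral_const_mul _ hm.lintegral_prod_right', lintegral_lintegral_swap hm.aemeasurable]
    _ = ENNReal.ofReal (π / 2) * (ENNReal.ofReal (π / 2) * ∫⁻ p, G p ∂(γ.prod γ)) := by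
        have hrot (θ : ℝ) : ∫⁻ p, G (ContinuousLinearMap.rotation θ p) ∂(γ.prod γ) =
            ∫⁻ p, G p ∂(γ.prod γ) :=
          (measurePreserving_rotation_gaussianRn n hδ θ).lintegral_comp hGm
        simp_rw [hrot]
        simp [mul_comm]
    _ ≤ ENNReal.ofReal (π / 2) * (ENNReal.ofReal (π / 2) * ((∫⁻ x, ‖fderiv ℝ g x‖ₑ ^ 2 ∂γ) *
          ENNReal.ofReal (4 * δ * 2 ^ ((n : ℝ) / 2)))) := by
        rw [hprod]
        gcongr
        exact lintegral_sq_norm_gaussianRn_le n hδ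
    _ = _ := by
        rw [mul_comm (∫⁻ x, ‖fderiv ℝ g x‖ₑ ^ 2 ∂γ), ← mul_assoc, ← mul_assoc,
          ← ENNReal.ofReal_mul (by positivity), ← ENNReal.ofReal_mul (by positivity)]
        congr 2
        ring

lemma lintegral_mconvn {n : ℕ} (μ ν : Measure (EuclideanSpace ℝ (Fin n))) [SFinite ν]
    {F : EuclideanSpace ℝ (Fin n) → ENNReal} (hF : Measurable F) :
    ∫⁻ x, F x ∂(mconvn μ ν) = ∫⁻ y, ∫⁻ x, F (y + x) ∂ν ∂μ := by
  rw [mconvn, lintegral_map hF (by fun_prop), lintegral_prod _ (by fun_prop)]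

/-- A Gaussian centered at `y` concentrates around the mean of the Gaussian centered at `0`. -/
lemma lintegral_sq_enorm_sub_mean_gaussianRn_le {n : ℕ} {δ : ℝ} (hδ : 0 < δ)
    {g : EuclideanSpace ℝ (Fin n) → ℝ} (hg : ContDiff ℝ (⊤ : ℕ∞) g)
    (hint : Integrable g (gaussianRn n δ)) (y : EuclideanSpace ℝ (Fin n)) :
    ∫⁻ x, ‖g (y + x) - ∫ z, g z ∂(gaussianRn n δ)‖ₑ ^ 2 ∂(gaussianRn n δ) ≤
      ENNReal.ofReal (Real.exp (‖y‖ ^ 2 / δ) * (π ^ 2 * δ * 2 ^ ((n : ℝ) / 2))) *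
        ∫⁻ x, ‖fderiv ℝ g (y + x)‖ₑ ^ 2 ∂(gaussianRn n δ) := by
  have := isProbabilityMeasure_gaussianRn n hδ
  set γ := gaussianRn n δ
  have hgc : Continuous g := hg.continuous
  have hpt (x : EuclideanSpace ℝ (Fin n)) : ‖g (y + x) - ∫ z, g z ∂γ‖ₑ ^ 2 ≤
      ENNReal.ofReal (Real.exp (‖y‖ ^ 2 / δ)) * ∫⁻ z, ‖g (y + z) - g (y + x)‖ₑ ^ 2 ∂γ := by
    refine le_trans ?_ (sq_lintegral_gaussianRn_le_translate n hδ y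
      (F := fun z => ‖g z - g (y + x)‖ₑ) (by fun_prop))
    gcongr
    have : ∫ z, (g z - g (y + x)) ∂γ = (∫ z, g z ∂γ) - g (y + x) := by
      rw [integral_sub hint (integrable_const _)]
      simp
    rw [← enorm_neg, neg_sub, ← this]
    exact enorm_integral_le_lintegral_enorm _
  refine (lintegral_mono hpt).trans ?_
  rw [lintegral_const_mul' _ _ ENNReal.ofReal_ne_top, ENNReal.ofReal_mul (by positivity), mul_assoc]
  gcongr
  have h := lintegral_sq_enorm_sub_gaussianRn_le hδ (g := fun x => g (y + x)) (by fun_prop)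
  simpa only [fderiv_comp_add_left] using h

lemma poincare_constant_le (n : ℕ) (hn : 1 ≤ n) {R δ : ℝ} (hδpos : 0 < δ) (hδ : δ ≤ R ^ 2) :
    Real.exp (R ^ 2 / δ) * (π ^ 2 * δ * 2 ^ ((n : ℝ) / 2)) ≤
      (8 + 144 / (Real.exp 1 * π ^ 2)) * R ^ 2 * Real.exp (17 * n + 25 * R ^ 2 / (8 * δ)) := by
  have hn' : (1 : ℝ) ≤ n := by exact_mod_cast hn
  have h1 : Real.exp (R ^ 2 / δ) ≤ Real.exp (25 * R ^ 2 / (8 * δ)) := by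
    rw [Real.exp_le_exp, div_le_div_iff₀ hδpos (by positivity)]
    nlinarith [mul_nonneg (sq_nonneg R) hδpos.le]
  have h2 : (2 : ℝ) ^ ((n : ℝ) / 2) ≤ Real.exp n := by
    rw [Real.rpow_def_of_pos two_pos]
    gcongr
    nlinarith [Real.log_two_lt_d9]
  have h3 : π ^ 2 ≤ 8 * Real.exp (16 * n) := by
    nlinarith [Real.pi_lt_four, Real.pi_pos, Real.add_one_le_exp (16 * (n : ℝ))]
  have h4 : (8 : ℝ) ≤ 8 + 144 / (Real.exp 1 * π ^ 2) := by
    have : 0 ≤ 144 / (Real.exp 1 * π ^ 2) := by positivity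
    linarith
  calc _ ≤ Real.exp (25 * R ^ 2 / (8 * δ)) * (8 * Real.exp (16 * n) * R ^ 2 * Real.exp n) := by
        gcongr
    _ = 8 * R ^ 2 * Real.exp (17 * n + 25 * R ^ 2 / (8 * δ)) := by
        rw [show (17 * n + 25 * R ^ 2 / (8 * δ) : ℝ) = 25 * R ^ 2 / (8 * δ) + 16 * n + n by ring,
          Real.exp_add, Real.exp_add]
        ring
    _ ≤ _ := by gcongr

theorem stmt3 (n : ℕ) (hn : 1 ≤ n) (R δ : ℝ) (hR : 0 < R) (hδpos : 0 < δ) (hδ : δ ≤ R ^ 2)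
    (μ : Measure (EuclideanSpace ℝ (Fin n))) [IsProbabilityMeasure μ]
    (hsupp : μ (Metric.closedBall 0 R)ᶜ = 0) :
    ∀ g : EuclideanSpace ℝ (Fin n) → ℝ, ContDiff ℝ (⊤ : ℕ∞) g → HasCompactSupport g →
      (∫ x, g x ∂(mconvn μ (gaussianRn n δ))) = 0 →
      ∫ x, g x ^ 2 ∂(mconvn μ (gaussianRn n δ)) ≤
        (8 + 144 / (Real.exp 1 * π ^ 2)) * R ^ 2 * Real.exp (17 * n + 25 * R ^ 2 / (8 * δ)) *
          ∫ x, ‖gradient g x‖ ^ 2 ∂(mconvn μ (gaussianRn n δ)) := by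
  intro g hg hgs hg0
  have hγ := isProbabilityMeasure_gaussianRn n hδpos
  set ν := mconvn μ (gaussianRn n δ) with hν
  have : IsProbabilityMeasure ν := Measure.isProbabilityMeasure_map (by fun_prop)
  have hgc : Continuous g := hg.continuous
  have hfd : Continuous (fderiv ℝ g) := hg.continuous_fderiv (by simp)
  have hgi : Integrable g ν := hgc.integrable_of_hasCompactSupport hgs
  have hg2i : Integrable (fun x => g x ^ 2) ν :=
    Continuous.integrable_of_hasCompactSupport (by fun_prop)
      (hgs.comp_left (g := fun t : ℝ => t ^ 2) (zero_pow two_ne_zero))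
  have hnorm (x) : ‖gradient g x‖ = ‖fderiv ℝ g x‖ := by simp [gradient]
  simp_rw [hnorm]
  have hfi : Integrable (fun x => ‖fderiv ℝ g x‖ ^ 2) ν :=
    Continuous.integrable_of_hasCompactSupport (by fun_prop)
      ((hgs.fderiv ℝ).comp_left (g := fun t => ‖t‖ ^ 2) (by simp))
  set m := ∫ z, g z ∂(gaussianRn n δ)
  set K := (8 + 144 / (Real.exp 1 * π ^ 2)) * R ^ 2 *
    Real.exp (17 * n + 25 * R ^ 2 / (8 * δ))
  have hK0 : 0 ≤ K := by positivity
  have hsq : (fun x => (g x - m) ^ 2) = fun x => g x ^ 2 - 2 * m * g x + m ^ 2 := by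
    ext x
    ring
  have hcross : Integrable (fun x => g x ^ 2 - 2 * m * g x) ν := hg2i.sub (hgi.const_mul _)
  have hmi : Integrable (fun x => (g x - m) ^ 2) ν := by
    rw [hsq]
    exact hcross.add (integrable_const _)
  have hexpand : ∫ x, (g x - m) ^ 2 ∂ν = ∫ x, g x ^ 2 ∂ν + m ^ 2 := by
    rw [hsq, integral_add hcross (integrable_const _), integral_sub hg2i (hgi.const_mul _),
      integral_const_mul, hg0]
    simp
  have hsupp' : ∀ᵐ y ∂μ, ‖y‖ ≤ R := by
    filter_upwards [compl_mem_ae_iff.mpr hsupp] with y hy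
    simpa using hy
  have hmain : ∫⁻ x, ‖g x - m‖ₑ ^ 2 ∂ν ≤
      ENNReal.ofReal K * ∫⁻ x, ‖fderiv ℝ g x‖ₑ ^ 2 ∂ν := by
    rw [hν, lintegral_mconvn _ _ (by fun_prop),
      lintegral_mconvn _ _ (hfd.enorm.measurable.pow_const 2),
      ← lintegral_const_mul' _ _ ENNReal.ofReal_ne_top]
    refine lintegral_mono_ae ?_
    filter_upwards [hsupp'] with y hy
    refine (lintegral_sq_enorm_sub_mean_gaussianRn_le hδpos hg
      (hgc.integrable_of_hasCompactSupport hgs) y).trans ?_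
    gcongr
    refine le_trans ?_ (poincare_constant_le n hn hδpos hδ)
    gcongr
  have h1 : ∫⁻ x, ‖g x - m‖ₑ ^ 2 ∂ν = ENNReal.ofReal (∫ x, (g x - m) ^ 2 ∂ν) := by
    rw [ofReal_integral_eq_lintegral_ofReal hmi (.of_forall fun _ => by positivity)]
    refine lintegral_congr fun x => ?_
    rw [← ofReal_norm, ← ENNReal.ofReal_pow (norm_nonneg _), Real.norm_eq_abs, sq_abs]
  have h2 : ∫⁻ x, ‖fderiv ℝ g x‖ₑ ^ 2 ∂ν = ENNReal.ofReal (∫ x, ‖fderiv ℝ g x‖ ^ 2 ∂ν) := by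
    rw [ofReal_integral_eq_lintegral_ofReal hfi (.of_forall fun _ => by positivity)]
    refine lintegral_congr fun x => ?_
    rw [← ofReal_norm, ← ENNReal.ofReal_pow (norm_nonneg _)]
  rw [h1, h2, ← ENNReal.ofReal_mul hK0, ENNReal.ofReal_le_ofReal_iff
    (mul_nonneg hK0 (integral_nonneg fun _ => by positivity)), hexpand] at hmain
  linarith [sq_nonneg m]
end

section
/- Let R > 0, let μ be a probability measure on ℝ supported in [−R, R], let δ > 0, let p_δ be the density of μ_δ = μ * γ_δ, and let m_δ be a median of μ_δ. Define D₁(δ) = sup_{x > m_δ} [ (∫_x^∞ p_δ(t) dt) · log(1 / ∫_x^∞ p_δ(t) dt) · ∫_{m_δ}^x (1/p_δ(t)) dt ] and D₀(δ) = sup_{x < m_δ} [ (∫_{−∞}^x p_δ(t) dt) · log(1 / ∫_{−∞}^x p_δ(t) dt) · ∫_x^{m_δ} (1/p_δ(t)) dt ]. Then both D₀(δ) and D₁(δ) are at most (8√(2π)/e) · (δ^{3/2} R / (4R² + δ)) · exp(2R²/δ) + (2/3)(2π + 1)(1 + √2)(√δ + 2R)². -/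
open MeasureTheory Real ENNReal

/-- Centered Gaussian measure on ℝ of variance δ. -/
noncomputable def gaussianMeasure (δ : ℝ) : Measure ℝ :=
  volume.withDensity fun t => ENNReal.ofReal ((Real.sqrt (2 * π * δ))⁻¹ * Real.exp (-(t ^ 2) / (2 * δ)))

/-- Convolution of two measures on ℝ. -/
noncomputable def mconv (μ ν : Measure ℝ) : Measure ℝ :=
  (μ.prod ν).map fun p => p.1 + p.2

/-- Density of the convolution μ * γ_δ on ℝ. -/
noncomputable def pdelta (δ : ℝ) (μ : Measure ℝ) (t : ℝ) : ℝ :=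
  ∫ s, (Real.sqrt (2 * π * δ))⁻¹ * Real.exp (-((t - s) ^ 2) / (2 * δ)) ∂μ

open ProbabilityTheory

lemma gaussianMeasure_eq_gaussianReal {δ : ℝ} (hδ : 0 < δ) :
    gaussianMeasure δ = gaussianReal 0 δ.toNNReal := by
  rw [gaussianReal_of_var_ne_zero _ (by simpa using hδ)]
  unfold gaussianMeasure
  congr 1
  ext t
  simp [gaussianPDF, gaussianPDFReal, hδ.le]

lemma gaussianMeasure_Ici_neg {δ : ℝ} (hδ : 0 < δ) (c : ℝ) :
    gaussianMeasure δ (Set.Ici (-c)) = gaussianMeasure δ (Set.Iic c) := by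
  rw [gaussianMeasure_eq_gaussianReal hδ]
  have h := gaussianReal_map_neg (μ := 0) (v := δ.toNNReal)
  rw [neg_zero] at h
  conv_rhs => rw [← h]
  rw [Measure.map_apply measurable_neg measurableSet_Iic]
  congr 1
  ext t
  simp

lemma gaussianMeasure_Iic_lt_half {δ : ℝ} (hδ : 0 < δ) {c : ℝ} (hc : c < 0) :
    gaussianMeasure δ (Set.Iic c) < 1 / 2 := by
  have hsymm := gaussianMeasure_Ici_neg hδ c
  rw [gaussianMeasure_eq_gaussianReal hδ] at *
  set γ := gaussianReal 0 δ.toNNReal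
  have hv : δ.toNNReal ≠ 0 := by simpa using hδ
  have hpos : γ (Set.Ioo c (-c)) ≠ 0 := by
    intro h0
    have h1 := gaussianReal_absolutelyContinuous' 0 hv h0
    rw [Real.volume_Ioo] at h1
    simp only [ofReal_eq_zero] at h1
    linarith
  have hdisj : Disjoint (Set.Iic c) (Set.Ici (-c)) :=
    Set.disjoint_left.2 fun t h1 h2 => by
      simp only [Set.mem_Iic, Set.mem_Ici] at h1 h2
      linarith
  have hsum : γ (Set.Iic c) + γ (Set.Ici (-c)) + γ (Set.Ioo c (-c)) ≤ 1 := by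
    rw [← measure_union hdisj measurableSet_Ici, ← measure_union _ measurableSet_Ioo]
    · exact prob_le_one
    · refine Set.disjoint_left.2 fun t h1 h2 => ?_
      simp only [Set.mem_union, Set.mem_Iic, Set.mem_Ici, Set.mem_Ioo] at h1 h2
      rcases h1 with h1 | h1 <;> linarith
  rw [hsymm] at hsum
  by_contra! hge
  have h2 : (1 : ℝ≥0∞) + γ (Set.Ioo c (-c)) ≤ 1 := by
    refine le_trans ?_ hsum
    gcongr
    calc (1 : ℝ≥0∞) = 1 / 2 + 1 / 2 := (ENNReal.add_halves 1).symm
      _ ≤ _ := add_le_add hge hge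
  have h3 : (1 : ℝ≥0∞) + γ (Set.Ioo c (-c)) ≤ 1 + 0 := by simpa only [add_zero] using h2
  exact hpos (nonpos_iff_eq_zero.1 ((ENNReal.add_le_add_iff_left one_ne_top).1 h3))

lemma mconv_gaussianMeasure_le {δ : ℝ} (hδ : 0 < δ) (μ : Measure ℝ) [IsProbabilityMeasure μ]
    {A B : Set ℝ} (hA : MeasurableSet A)
    (h : ∀ᵐ s ∂μ, ∀ t, s + t ∈ A → t ∈ B) :
    mconv μ (gaussianMeasure δ) A ≤ gaussianMeasure δ B := by
  rw [gaussianMeasure_eq_gaussianReal hδ]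
  set γ := gaussianReal 0 δ.toNNReal
  unfold mconv
  have hm : Measurable fun p : ℝ × ℝ => p.1 + p.2 := by fun_prop
  rw [Measure.map_apply hm hA, Measure.prod_apply (hm hA)]
  calc _ ≤ ∫⁻ _, γ B ∂μ := by
        refine lintegral_mono_ae ?_
        filter_upwards [h] with s hs
        exact measure_mono fun t ht => hs t ht
    _ = γ B := by simp

lemma ae_mem_Icc {R : ℝ} {μ : Measure ℝ} (hsupp : μ (Set.Icc (-R) R)ᶜ = 0) :
    ∀ᵐ s ∂μ, s ∈ Set.Icc (-R) R := hsupp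

lemma neg_le_of_half_le_mconv_Iic {R δ m : ℝ} (hδ : 0 < δ) (μ : Measure ℝ)
    [IsProbabilityMeasure μ] (hsupp : μ (Set.Icc (-R) R)ᶜ = 0)
    (hm : (1 : ℝ≥0∞) / 2 ≤ mconv μ (gaussianMeasure δ) (Set.Iic m)) : -R ≤ m := by
  by_contra! hlt
  refine absurd (hm.trans ?_) (not_le.2 (gaussianMeasure_Iic_lt_half hδ (c := m + R) (by linarith)))
  refine mconv_gaussianMeasure_le hδ μ measurableSet_Iic ?_
  filter_upwards [ae_mem_Icc hsupp] with s hs t ht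
  simp only [Set.mem_Iic] at ht ⊢
  linarith [hs.1]

lemma le_of_half_le_mconv_Ici {R δ m : ℝ} (hδ : 0 < δ) (μ : Measure ℝ)
    [IsProbabilityMeasure μ] (hsupp : μ (Set.Icc (-R) R)ᶜ = 0)
    (hm : (1 : ℝ≥0∞) / 2 ≤ mconv μ (gaussianMeasure δ) (Set.Ici m)) : m ≤ R := by
  by_contra! hlt
  refine absurd (hm.trans ?_) (not_le.2 (gaussianMeasure_Iic_lt_half hδ (c := R - m) (by linarith)))
  rw [← gaussianMeasure_Ici_neg hδ]
  refine mconv_gaussianMeasure_le hδ μ measurableSet_Ici ?_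
  filter_upwards [ae_mem_Icc hsupp] with s hs t ht
  simp only [Set.mem_Ici] at ht ⊢
  linarith [hs.2]

/-- A Dawson-type bound for the integral of `exp (u ^ 2 / (2 * δ))`. -/
lemma integral_exp_sq_le {δ a : ℝ} (hδ : 0 < δ) (ha : 0 ≤ a) :
    ∫ u in (0 : ℝ)..a, exp (u ^ 2 / (2 * δ)) ≤
      2 * δ * a / (a ^ 2 + δ) * exp (a ^ 2 / (2 * δ)) := by
  have hF : ∀ u : ℝ, HasDerivAt (fun u => 2 * δ * u / (u ^ 2 + δ) * exp (u ^ 2 / (2 * δ)))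
      ((2 * δ ^ 2 + 2 * u ^ 4) / (u ^ 2 + δ) ^ 2 * exp (u ^ 2 / (2 * δ))) u := by
    intro u
    have hne : u ^ 2 + δ ≠ 0 := by positivity
    have h1 : HasDerivAt (fun u : ℝ => 2 * δ * u) (2 * δ) u := by
      simpa using (hasDerivAt_id u).const_mul (2 * δ)
    have h2 : HasDerivAt (fun u : ℝ => u ^ 2 + δ) (2 * u) u := by
      simpa using (hasDerivAt_pow 2 u).add_const δ
    have h3 : HasDerivAt (fun u : ℝ => u ^ 2 / (2 * δ)) (2 * u / (2 * δ)) u := by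
      simpa using (hasDerivAt_pow 2 u).div_const (2 * δ)
    refine ((h1.div h2 hne).mul h3.exp).congr_deriv ?_
    simp only [Pi.div_apply]
    field_simp
    ring
  have hc : Continuous fun u : ℝ => (2 * δ ^ 2 + 2 * u ^ 4) / (u ^ 2 + δ) ^ 2 *
      exp (u ^ 2 / (2 * δ)) := by
    refine Continuous.mul (Continuous.div (by fun_prop) (by fun_prop) fun u => ?_) (by fun_prop)
    positivity
  have hint := intervalIntegral.integral_eq_sub_of_hasDerivAt (a := 0) (b := a)
    (fun u _ => hF u) (hc.intervalIntegrable 0 a)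
  calc _ ≤ ∫ u in (0 : ℝ)..a, (2 * δ ^ 2 + 2 * u ^ 4) / (u ^ 2 + δ) ^ 2 *
        exp (u ^ 2 / (2 * δ)) := by
        refine intervalIntegral.integral_mono_on ha
          (Continuous.intervalIntegrable (by fun_prop) _ _) (hc.intervalIntegrable 0 a) ?_
        intro u _
        refine le_mul_of_one_le_left (exp_pos _).le ?_
        rw [one_le_div (by positivity)]
        nlinarith [sq_nonneg (u ^ 2 - δ)]
    _ = _ := by rw [hint]; simp

lemma pdelta_map_neg {δ : ℝ} {μ : Measure ℝ} (t : ℝ) : pdelta δ (μ.map Neg.neg) t = pdelta δ μ (-t) := by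
  unfold pdelta
  rw [integral_map measurable_neg.aemeasurable (Continuous.aestronglyMeasurable (by fun_prop))]
  refine integral_congr_ae (.of_forall fun s => ?_)
  ring_nf

section pdelta

variable {R δ : ℝ} {μ : Measure ℝ} [IsProbabilityMeasure μ]

lemma integrable_pdelta_kernel (hδ : 0 < δ) (t : ℝ) :
    Integrable (fun s => (√(2 * π * δ))⁻¹ * exp (-((t - s) ^ 2) / (2 * δ))) μ := by
  refine Integrable.of_bound (C := (√(2 * π * δ))⁻¹)
    (Continuous.aestronglyMeasurable (by fun_prop)) (.of_forall fun s => ?_)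
  rw [norm_of_nonneg (by positivity)]
  refine mul_le_of_le_one_right (by positivity) (exp_le_one_iff.2 ?_)
  exact div_nonpos_of_nonpos_of_nonneg (by nlinarith [sq_nonneg (t - s)]) (by positivity)

lemma continuous_pdelta (hδ : 0 < δ) : Continuous (pdelta δ μ) := by
  refine continuous_of_dominated (bound := fun _ => (√(2 * π * δ))⁻¹)
    (fun t => (integrable_pdelta_kernel hδ t).aestronglyMeasurable) (fun t => .of_forall fun s => ?_)
    (integrable_const _) (.of_forall fun s => by fun_prop)
  rw [norm_of_nonneg (by positivity)]
  refine mul_le_of_le_one_right (by positivity) (exp_le_one_iff.2 ?_)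
  exact div_nonpos_of_nonpos_of_nonneg (by nlinarith [sq_nonneg (t - s)]) (by positivity)

lemma le_pdelta (hδ : 0 < δ) (hsupp : μ (Set.Icc (-R) R)ᶜ = 0) {t r : ℝ}
    (h : ∀ s ∈ Set.Icc (-R) R, (t - s) ^ 2 ≤ r) :
    (√(2 * π * δ))⁻¹ * exp (-r / (2 * δ)) ≤ pdelta δ μ t := by
  calc _ = ∫ _, (√(2 * π * δ))⁻¹ * exp (-r / (2 * δ)) ∂μ := by simp
    _ ≤ _ := by
      refine integral_mono_ae (integrable_const _) (integrable_pdelta_kernel hδ t) ?_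
      filter_upwards [ae_mem_Icc hsupp] with s hs
      gcongr
      exact h s hs

lemma pdelta_pos (hδ : 0 < δ) (hsupp : μ (Set.Icc (-R) R)ᶜ = 0) (t : ℝ) : 0 < pdelta δ μ t := by
  refine lt_of_lt_of_le ?_ (le_pdelta hδ hsupp (t := t) (r := (|t| + R) ^ 2) fun s hs => ?_)
  · positivity
  · refine sq_le_sq' ?_ ?_ <;> linarith [hs.1, hs.2, neg_abs_le t, le_abs_self t]

lemma continuous_inv_pdelta (hδ : 0 < δ) (hsupp : μ (Set.Icc (-R) R)ᶜ = 0) :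
    Continuous fun t => (pdelta δ μ t)⁻¹ :=
  (continuous_pdelta hδ).inv₀ fun t => (pdelta_pos hδ hsupp t).ne'

lemma pdelta_le_mul_exp (hδ : 0 < δ) (hsupp : μ (Set.Icc (-R) R)ᶜ = 0) {t x r : ℝ}
    (h : ∀ s ∈ Set.Icc (-R) R, (x - s) ^ 2 ≤ (t - s) ^ 2 + r) :
    pdelta δ μ t ≤ exp (r / (2 * δ)) * pdelta δ μ x := by
  unfold pdelta
  rw [← integral_const_mul]
  refine integral_mono_ae (integrable_pdelta_kernel hδ t)
    ((integrable_pdelta_kernel hδ x).const_mul _) ?_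
  filter_upwards [ae_mem_Icc hsupp] with s hs
  rw [mul_left_comm, ← exp_add, ← add_div]
  gcongr
  linarith [h s hs]

lemma pdelta_le_tail (hδ : 0 < δ) (hsupp : μ (Set.Icc (-R) R)ᶜ = 0) {t x : ℝ} (ht : x < t) :
    pdelta δ μ t ≤ exp ((x - R) * x / δ) * pdelta δ μ x * exp (-((x - R) / δ) * t) := by
  refine (pdelta_le_mul_exp hδ hsupp (x := x) (r := -(2 * (x - R) * (t - x))) fun s hs => ?_).trans_eq ?_
  · nlinarith [sq_nonneg (t - x), mul_nonneg (sub_nonneg.2 ht.le) (sub_nonneg.2 hs.2)]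
  · rw [mul_right_comm (exp ((x - R) * x / δ)), ← exp_add]
    congr 2
    field_simp
    ring

lemma integrableOn_pdelta_Ioi (hδ : 0 < δ) (hsupp : μ (Set.Icc (-R) R)ᶜ = 0) {x : ℝ}
    (hx : R < x) : IntegrableOn (pdelta δ μ) (Set.Ioi x) := by
  refine Integrable.mono' (g := fun t => exp ((x - R) * x / δ) * pdelta δ μ x *
    exp (-((x - R) / δ) * t)) ?_ (continuous_pdelta hδ).aestronglyMeasurable ?_
  · exact (exp_neg_integrableOn_Ioi x (div_pos (sub_pos.2 hx) hδ)).const_mul _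
  · filter_upwards [ae_restrict_mem measurableSet_Ioi] with t ht
    rw [norm_of_nonneg (pdelta_pos hδ hsupp t).le]
    exact pdelta_le_tail hδ hsupp ht

lemma integral_Ioi_pdelta_le (hδ : 0 < δ) (hsupp : μ (Set.Icc (-R) R)ᶜ = 0) {x : ℝ}
    (hx : R < x) : ∫ t in Set.Ioi x, pdelta δ μ t ≤ δ / (x - R) * pdelta δ μ x := by
  have hk : 0 < (x - R) / δ := div_pos (sub_pos.2 hx) hδ
  calc _ ≤ ∫ t in Set.Ioi x, exp ((x - R) * x / δ) * pdelta δ μ x *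
        exp (-((x - R) / δ) * t) :=
        setIntegral_mono_on (integrableOn_pdelta_Ioi hδ hsupp hx)
          ((exp_neg_integrableOn_Ioi x hk).const_mul _) measurableSet_Ioi
          fun t ht => pdelta_le_tail hδ hsupp ht
    _ = _ := by
      rw [integral_const_mul, integral_exp_mul_Ioi (neg_lt_zero.2 hk)]
      have h0 : exp ((x - R) * x / δ) * exp (-((x - R) / δ) * x) = 1 := by
        rw [← exp_add, exp_eq_one_iff]
        ring
      have h1 : x - R ≠ 0 := (sub_pos.2 hx).ne'
      calc _ = (exp ((x - R) * x / δ) * exp (-((x - R) / δ) * x)) *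
            (pdelta δ μ x * (1 / ((x - R) / δ))) := by
            rw [neg_div_neg_eq]; ring
        _ = _ := by rw [h0]; field_simp

lemma integral_inv_pdelta_tail_le (hδ : 0 < δ) (hsupp : μ (Set.Icc (-R) R)ᶜ = 0) {x : ℝ}
    (hx : R < x) : ∫ t in R..x, (pdelta δ μ t)⁻¹ ≤
      (pdelta δ μ x)⁻¹ * (2 * δ * (x - R) / ((x - R) ^ 2 + δ)) := by
  have hbound : ∀ t ∈ Set.Icc R x, (pdelta δ μ t)⁻¹ ≤
      (pdelta δ μ x)⁻¹ * exp (-(x - R) ^ 2 / (2 * δ)) * exp ((t - R) ^ 2 / (2 * δ)) := by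
    intro t ht
    have h := pdelta_le_mul_exp hδ hsupp (t := x) (x := t)
      (r := (t - R) ^ 2 - (x - R) ^ 2) fun s hs => by
        nlinarith [mul_nonneg (sub_nonneg.2 ht.2) (sub_nonneg.2 hs.2)]
    rw [mul_assoc, ← exp_add, ← add_div, neg_add_eq_sub, ← div_eq_inv_mul,
      le_div_iff₀ (pdelta_pos hδ hsupp x), inv_mul_le_iff₀ (pdelta_pos hδ hsupp t), mul_comm]
    exact h
  calc _ ≤ ∫ t in R..x, (pdelta δ μ x)⁻¹ * exp (-(x - R) ^ 2 / (2 * δ)) *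
        exp ((t - R) ^ 2 / (2 * δ)) :=
        intervalIntegral.integral_mono_on hx.le
          ((continuous_inv_pdelta hδ hsupp).intervalIntegrable _ _)
          (Continuous.intervalIntegrable (by fun_prop) _ _) hbound
    _ = (pdelta δ μ x)⁻¹ * exp (-(x - R) ^ 2 / (2 * δ)) *
        ∫ u in (0 : ℝ)..(x - R), exp (u ^ 2 / (2 * δ)) := by
        rw [intervalIntegral.integral_const_mul,
          intervalIntegral.integral_comp_sub_right (fun u => exp (u ^ 2 / (2 * δ))) R, sub_self]
    _ ≤ (pdelta δ μ x)⁻¹ * exp (-(x - R) ^ 2 / (2 * δ)) *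
        (2 * δ * (x - R) / ((x - R) ^ 2 + δ) * exp ((x - R) ^ 2 / (2 * δ))) := by
        have := pdelta_pos hδ hsupp x
        gcongr
        exact integral_exp_sq_le hδ (sub_pos.2 hx).le
    _ = _ := by
        have h0 : exp (-(x - R) ^ 2 / (2 * δ)) * exp ((x - R) ^ 2 / (2 * δ)) = 1 := by
          rw [← exp_add, exp_eq_one_iff]
          ring
        linear_combination (pdelta δ μ x)⁻¹ * (2 * δ * (x - R) / ((x - R) ^ 2 + δ)) * h0

lemma exp_neg_le_integral_Ioi_pdelta (hδ : 0 < δ) (hR : 0 < R)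
    (hsupp : μ (Set.Icc (-R) R)ᶜ = 0) {x : ℝ} (hx : R < x) :
    exp (-((x - R + (√δ + 2 * R)) ^ 2 / (2 * δ) + 1)) ≤ ∫ t in Set.Ioi x, pdelta δ μ t := by
  have hσ : 0 < √δ := sqrt_pos.2 hδ
  have h2π : √(2 * π) ≤ exp 1 := by
    rw [sqrt_le_left (exp_pos 1).le]
    nlinarith [pi_lt_d2, exp_one_gt_d9]
  calc _ = (exp 1)⁻¹ * exp (-(x - R + (√δ + 2 * R)) ^ 2 / (2 * δ)) := by
        rw [← exp_neg, ← exp_add]; ring_nf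
    _ ≤ (√(2 * π))⁻¹ * exp (-(x - R + (√δ + 2 * R)) ^ 2 / (2 * δ)) := by gcongr
    _ = ∫ _ in x..(x + √δ), (√(2 * π * δ))⁻¹ *
          exp (-(x - R + (√δ + 2 * R)) ^ 2 / (2 * δ)) := by
        rw [intervalIntegral.integral_const, sqrt_mul (x := 2 * π) (by positivity), smul_eq_mul,
          add_sub_cancel_left, mul_inv]
        field_simp
    _ ≤ ∫ t in x..(x + √δ), pdelta δ μ t := by
        refine intervalIntegral.integral_mono_on (by linarith) (by simp)
          ((continuous_pdelta hδ).intervalIntegrable _ _) fun t ht => ?_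
        refine le_pdelta hδ hsupp fun s hs => ?_
        refine sq_le_sq' ?_ ?_ <;> linarith [hs.1, hs.2, ht.1, ht.2]
    _ ≤ _ := by
        rw [intervalIntegral.integral_of_le (by linarith)]
        exact setIntegral_mono_set (integrableOn_pdelta_Ioi hδ hsupp hx)
          (.of_forall fun t => (pdelta_pos hδ hsupp t).le)
          Set.Ioc_subset_Ioi_self.eventuallyLE

lemma integral_inv_pdelta_center_le (hδ : 0 < δ) (hR : 0 < R)
    (hsupp : μ (Set.Icc (-R) R)ᶜ = 0) :
    ∫ t in (-R)..R, (pdelta δ μ t)⁻¹ ≤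
      8 * √(2 * π) * (δ ^ ((3 : ℝ) / 2) * R / (4 * R ^ 2 + δ)) * exp (2 * R ^ 2 / δ) := by
  have hbound : ∀ t ∈ Set.Icc (-R) R, (pdelta δ μ t)⁻¹ ≤
      √(2 * π * δ) * (exp ((R - t) ^ 2 / (2 * δ)) + exp ((R + t) ^ 2 / (2 * δ))) := by
    intro t ht
    have hinv : ∀ r : ℝ, (√(2 * π * δ))⁻¹ * exp (-r / (2 * δ)) ≤ pdelta δ μ t →
        (pdelta δ μ t)⁻¹ ≤ √(2 * π * δ) * exp (r / (2 * δ)) := by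
      intro r hr
      refine (inv_anti₀ (by positivity) hr).trans_eq ?_
      rw [mul_inv, inv_inv, ← exp_neg, neg_div, neg_neg]
    have h3 : 0 ≤ √(2 * π * δ) * exp ((R - t) ^ 2 / (2 * δ)) := by positivity
    have h4 : 0 ≤ √(2 * π * δ) * exp ((R + t) ^ 2 / (2 * δ)) := by positivity
    rw [mul_add]
    rcases le_total t 0 with h0 | h0
    · have := hinv ((R - t) ^ 2) (le_pdelta hδ hsupp fun s hs => by
        refine sq_le_sq' ?_ ?_ <;> linarith [hs.1, hs.2, ht.1, ht.2])
      linarith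
    · have := hinv ((R + t) ^ 2) (le_pdelta hδ hsupp fun s hs => by
        refine sq_le_sq' ?_ ?_ <;> linarith [hs.1, hs.2, ht.1, ht.2])
      linarith
  have hI := integral_exp_sq_le hδ (a := 2 * R) (by positivity)
  calc _ ≤ ∫ t in (-R)..R, √(2 * π * δ) *
        (exp ((R - t) ^ 2 / (2 * δ)) + exp ((R + t) ^ 2 / (2 * δ))) :=
        intervalIntegral.integral_mono_on (by linarith)
          ((continuous_inv_pdelta hδ hsupp).intervalIntegrable _ _)
          (Continuous.intervalIntegrable (by fun_prop) _ _) hbound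
    _ = √(2 * π * δ) * (2 * ∫ u in (0 : ℝ)..(2 * R), exp (u ^ 2 / (2 * δ))) := by
        have h0 : R - R = 0 := sub_self R
        have h1 : R + -R = 0 := add_neg_cancel R
        rw [intervalIntegral.integral_const_mul, intervalIntegral.integral_add
          (Continuous.intervalIntegrable (by fun_prop) _ _)
          (Continuous.intervalIntegrable (by fun_prop) _ _),
          intervalIntegral.integral_comp_sub_left (fun u => exp (u ^ 2 / (2 * δ))) R,
          intervalIntegral.integral_comp_add_left (fun u => exp (u ^ 2 / (2 * δ))) R,
          h0, h1, sub_neg_eq_add, ← two_mul, ← two_mul]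
    _ ≤ √(2 * π * δ) * (2 * (2 * δ * (2 * R) / ((2 * R) ^ 2 + δ) *
          exp ((2 * R) ^ 2 / (2 * δ)))) := by gcongr
    _ = _ := by
        have hpow : δ ^ ((3 : ℝ) / 2) = √δ * δ := by
          rw [sqrt_eq_rpow, ← rpow_add_one hδ.ne']
          norm_num
        have hexp : (2 * R) ^ 2 / (2 * δ) = 2 * R ^ 2 / δ := by
          field_simp
        rw [hpow, hexp, sqrt_mul (by positivity)]
        ring

lemma mul_log_inv_le (y : ℝ) (hy : 0 ≤ y) : y * Real.log (1 / y) ≤ (exp 1)⁻¹ := by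
  rcases hy.eq_or_lt with rfl | hy
  · simp [(exp_pos 1).le]
  · have h := Real.log_le_sub_one_of_pos (x := (exp 1)⁻¹ * (1 / y)) (by positivity)
    rw [Real.log_mul (by positivity) (by positivity), Real.log_inv, Real.log_exp] at h
    calc y * Real.log (1 / y) ≤ y * ((exp 1)⁻¹ * (1 / y)) := by gcongr; linarith
      _ = _ := by field_simp

lemma tail_mul_log_mul_integral_le (hδ : 0 < δ) (hR : 0 < R)
    (hsupp : μ (Set.Icc (-R) R)ᶜ = 0) {x : ℝ} (hx : R < x) :
    (∫ t in Set.Ioi x, pdelta δ μ t) * Real.log (1 / ∫ t in Set.Ioi x, pdelta δ μ t) *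
      ∫ t in R..x, (pdelta δ μ t)⁻¹ ≤
    2 / 3 * (2 * π + 1) * (1 + √2) * (√δ + 2 * R) ^ 2 := by
  have hp := pdelta_pos hδ hsupp x
  have hT := integral_Ioi_pdelta_le hδ hsupp hx
  have hB := integral_inv_pdelta_tail_le hδ hsupp hx
  have hL := exp_neg_le_integral_Ioi_pdelta hδ hR hsupp hx
  have hB0 : 0 ≤ ∫ t in R..x, (pdelta δ μ t)⁻¹ :=
    intervalIntegral.integral_nonneg hx.le fun t _ => (inv_pos.2 (pdelta_pos hδ hsupp t)).le
  set T := ∫ t in Set.Ioi x, pdelta δ μ t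
  set B := ∫ t in R..x, (pdelta δ μ t)⁻¹
  set y := x - R with hy
  set c := √δ + 2 * R with hc
  have hy0 : 0 < y := sub_pos.2 hx
  have hT0 : 0 < T := (exp_pos _).trans_le hL
  have hlog : Real.log (1 / T) ≤ (y + c) ^ 2 / (2 * δ) + 1 := by
    rw [one_div, Real.log_inv]
    have := (Real.le_log_iff_exp_le hT0).2 hL
    linarith
  have hδc : δ ≤ c ^ 2 := by
    nlinarith [sq_sqrt hδ.le, sqrt_nonneg δ, mul_nonneg (sqrt_nonneg δ) hR.le, sq_nonneg R]
  have hconst : 4 ≤ 2 / 3 * (2 * π + 1) * (1 + √2) := by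
    have h1 : 1 ≤ √2 := one_le_sqrt.2 (by norm_num)
    nlinarith [pi_gt_three]
  calc T * Real.log (1 / T) * B ≤ T * ((y + c) ^ 2 / (2 * δ) + 1) * B := by gcongr
    _ ≤ (δ / y * pdelta δ μ x) * ((y + c) ^ 2 / (2 * δ) + 1) *
        ((pdelta δ μ x)⁻¹ * (2 * δ * y / (y ^ 2 + δ))) := by gcongr
    _ = δ * ((y + c) ^ 2 + 2 * δ) / (y ^ 2 + δ) := by field_simp
    _ ≤ 4 * c ^ 2 := by
      rw [div_le_iff₀ (by positivity)]
      nlinarith [sq_nonneg (y - c), mul_nonneg (sub_nonneg.2 hδc) (sq_nonneg y),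
        mul_nonneg (sub_nonneg.2 hδc) hδ.le, mul_nonneg hδ.le (sq_nonneg (y - c))]
    _ ≤ _ := by gcongr

lemma tail_mul_log_mul_integral_inv_le (hδ : 0 < δ) (hR : 0 < R)
    (hsupp : μ (Set.Icc (-R) R)ᶜ = 0) {m x : ℝ} (hm : -R ≤ m) (hx : m < x) :
    (∫ t in Set.Ioi x, pdelta δ μ t) * Real.log (1 / ∫ t in Set.Ioi x, pdelta δ μ t) *
      ∫ t in m..x, (pdelta δ μ t)⁻¹ ≤
    8 * √(2 * π) / exp 1 * (δ ^ ((3 : ℝ) / 2) * R / (4 * R ^ 2 + δ)) * exp (2 * R ^ 2 / δ) +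
      2 / 3 * (2 * π + 1) * (1 + √2) * (√δ + 2 * R) ^ 2 := by
  have hcont := continuous_inv_pdelta hδ hsupp
  have hpos : ∀ t, 0 ≤ (pdelta δ μ t)⁻¹ := fun t => (inv_pos.2 (pdelta_pos hδ hsupp t)).le
  have hcenter := integral_inv_pdelta_center_le hδ hR hsupp
  have hT0 : 0 ≤ ∫ t in Set.Ioi x, pdelta δ μ t :=
    integral_nonneg fun t => (pdelta_pos hδ hsupp t).le
  have hTL := mul_log_inv_le _ hT0
  have htail := tail_mul_log_mul_integral_le hδ hR hsupp (x := x)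
  have h2 : 0 ≤ 2 / 3 * (2 * π + 1) * (1 + √2) * (√δ + 2 * R) ^ 2 := by positivity
  have hmono : ∀ {a b : ℝ}, -R ≤ a → a ≤ b → b ≤ max x R →
      ∫ t in a..b, (pdelta δ μ t)⁻¹ ≤ ∫ t in (-R)..(max x R), (pdelta δ μ t)⁻¹ :=
    fun h1 h2 h3 => intervalIntegral.integral_mono_interval h1 h2 h3
      (.of_forall hpos) (hcont.intervalIntegrable _ _)
  have hm0 : 0 ≤ ∫ t in m..x, (pdelta δ μ t)⁻¹ :=
    intervalIntegral.integral_nonneg hx.le fun t _ => hpos t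
  have hC0 : 0 ≤ ∫ t in (-R)..R, (pdelta δ μ t)⁻¹ :=
    intervalIntegral.integral_nonneg (by linarith) fun t _ => hpos t
  have hmx := hmono hm hx.le (le_max_left _ _)
  set T := ∫ t in Set.Ioi x, pdelta δ μ t
  have hfirst : T * Real.log (1 / T) * ∫ t in (-R)..R, (pdelta δ μ t)⁻¹ ≤
      8 * √(2 * π) / exp 1 * (δ ^ ((3 : ℝ) / 2) * R / (4 * R ^ 2 + δ)) *
        exp (2 * R ^ 2 / δ) := by
    calc _ ≤ (exp 1)⁻¹ * (8 * √(2 * π) * (δ ^ ((3 : ℝ) / 2) * R / (4 * R ^ 2 + δ)) *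
          exp (2 * R ^ 2 / δ)) := by gcongr
      _ = _ := by ring
  have hfirst0 : 0 ≤ 8 * √(2 * π) / exp 1 * (δ ^ ((3 : ℝ) / 2) * R / (4 * R ^ 2 + δ)) *
        exp (2 * R ^ 2 / δ) := by positivity
  rcases le_or_gt (T * Real.log (1 / T)) 0 with hneg | hTlog
  · exact (mul_nonpos_of_nonpos_of_nonneg hneg hm0).trans (add_nonneg hfirst0 h2)
  refine (mul_le_mul_of_nonneg_left hmx hTlog.le).trans ?_
  rcases le_or_gt x R with hxR | hxR
  · rw [max_eq_right hxR]
    linarith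
  · rw [max_eq_left hxR.le, ← intervalIntegral.integral_add_adjacent_intervals
      (hcont.intervalIntegrable (-R) R) (hcont.intervalIntegrable R x), mul_add]
    linarith [htail hxR]

end pdelta

/-- The bounds D₀(δ), D₁(δ) (expressed pointwise, i.e. every value occurring in the
defining suprema is bounded by the stated quantity). -/
theorem stmt11 (R δ : ℝ) (hR : 0 < R) (hδ : 0 < δ)
    (μ : Measure ℝ) [IsProbabilityMeasure μ] (hsupp : μ (Set.Icc (-R) R)ᶜ = 0)
    (m : ℝ)
    (hm₁ : (1 : ℝ≥0∞) / 2 ≤ mconv μ (gaussianMeasure δ) (Set.Iic m))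
    (hm₂ : (1 : ℝ≥0∞) / 2 ≤ mconv μ (gaussianMeasure δ) (Set.Ici m)) :
    (∀ x : ℝ, m < x →
      (∫ t in Set.Ioi x, pdelta δ μ t) *
          Real.log (1 / ∫ t in Set.Ioi x, pdelta δ μ t) *
          ∫ t in m..x, (pdelta δ μ t)⁻¹ ≤
        8 * Real.sqrt (2 * π) / Real.exp 1 *
            (δ ^ ((3 : ℝ) / 2) * R / (4 * R ^ 2 + δ)) * Real.exp (2 * R ^ 2 / δ) +
          2 / 3 * (2 * π + 1) * (1 + Real.sqrt 2) * (Real.sqrt δ + 2 * R) ^ 2) ∧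
    (∀ x : ℝ, x < m →
      (∫ t in Set.Iic x, pdelta δ μ t) *
          Real.log (1 / ∫ t in Set.Iic x, pdelta δ μ t) *
          ∫ t in x..m, (pdelta δ μ t)⁻¹ ≤
        8 * Real.sqrt (2 * π) / Real.exp 1 *
            (δ ^ ((3 : ℝ) / 2) * R / (4 * R ^ 2 + δ)) * Real.exp (2 * R ^ 2 / δ) +
          2 / 3 * (2 * π + 1) * (1 + Real.sqrt 2) * (Real.sqrt δ + 2 * R) ^ 2) := by
  refine ⟨fun x hx => tail_mul_log_mul_integral_inv_le hδ hR hsupp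
    (neg_le_of_half_le_mconv_Iic hδ μ hsupp hm₁) hx, fun x hx => ?_⟩
  have hprob : IsProbabilityMeasure (μ.map Neg.neg) :=
    Measure.isProbabilityMeasure_map measurable_neg.aemeasurable
  have hsupp' : (μ.map Neg.neg) (Set.Icc (-R) R)ᶜ = 0 := by
    rw [Measure.map_apply measurable_neg measurableSet_Icc.compl, ← hsupp]
    congr 1
    ext t
    simp only [Set.mem_preimage, Set.mem_compl_iff, Set.mem_Icc, neg_le_neg_iff, neg_le, and_comm]
  have h := tail_mul_log_mul_integral_inv_le hδ hR hsupp'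
    (neg_le_neg (le_of_half_le_mconv_Ici hδ μ hsupp hm₂)) (neg_lt_neg hx)
  simp only [pdelta_map_neg] at h
  rwa [integral_comp_neg_Ioi (-x) (pdelta δ μ),
    intervalIntegral.integral_comp_neg (fun t => (pdelta δ μ t)⁻¹), neg_neg, neg_neg] at h
end

section
/- Let R > 0, a > 0, and let μ be a probability measure on ℝ supported in [−R, R] such that μ(A) ≥ a · Leb(A ∩ [−R, R]) for every Borel set A (i.e. the absolutely continuous part of μ has density bounded below by a on [−R, R]). Then for every 0 < δ ≤ R², the convolution μ_δ = μ * γ_δ satisfies a logarithmic Sobolev inequality with constant c(δ) ≤ 2067 · (R/a) + 9016 · δ + 1248 · δ · log(1/(a²δ)). -/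
open MeasureTheory Real

/-- ν satisfies a logarithmic Sobolev inequality with constant c:
Ent_ν(f²) ≤ c ∫ |f'|² dν for all smooth compactly supported f : ℝ → ℝ. -/
def SatisfiesLSI (ν : Measure ℝ) (c : ℝ) : Prop :=
  ∀ f : ℝ → ℝ, ContDiff ℝ (⊤ : ℕ∞) f → HasCompactSupport f →
    Ent ν (fun t => f t ^ 2) ≤ c * ∫ t, deriv f t ^ 2 ∂ν

open ProbabilityTheory

/-- A continuous function of a bounded function is integrable for a finite measure. -/
lemma integrable_continuous_comp {α : Type*} [MeasurableSpace α] {ν : Measure α}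
    [IsFiniteMeasure ν] {u : α → ℝ} (hu : AEStronglyMeasurable u ν) {B : ℝ}
    (hB : ∀ x, |u x| ≤ B) {φ : ℝ → ℝ} (hφ : Continuous φ) :
    Integrable (fun x => φ (u x)) ν := by
  obtain ⟨C, hC⟩ := (isCompact_Icc (a := -B) (b := B)).exists_bound_of_continuousOn
    hφ.continuousOn
  exact Integrable.of_bound (hφ.comp_aestronglyMeasurable hu) C
    (Filter.Eventually.of_forall fun x => hC _ (abs_le.1 (hB x)))

lemma mul_log_div_sub_add_le {F t : ℝ} (hF : 0 ≤ F) (ht : 0 < t) :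
    F * log (F / t) - F + t ≤ (F - t) ^ 2 / t := by
  rcases hF.eq_or_lt with rfl | hF
  · simp [sq, ht.ne']
  · have h := log_le_sub_one_of_pos (div_pos hF ht)
    have h2 : F * log (F / t) ≤ F * (F / t - 1) := by gcongr
    have h3 : (F - t) ^ 2 / t = F * (F / t - 1) - F + t := by field_simp; ring
    linarith

lemma mul_log_div_sub_add_nonneg {F t : ℝ} (hF : 0 ≤ F) (ht : 0 < t) :
    0 ≤ F * log (F / t) - F + t := by
  rcases hF.eq_or_lt with rfl | hF
  · simp [ht.le]
  · have h := log_le_sub_one_of_pos (div_pos ht hF)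
    have h2 : F * log (t / F) ≤ F * (t / F - 1) := by gcongr
    have h3 : log (F / t) = - log (t / F) := by rw [← log_inv, inv_div]
    have h4 : F * (t / F - 1) = t - F := by field_simp
    rw [h3]; linarith

/-- Pointwise form of Rothaus' inequality, with non-optimal constants. -/
lemma sq_add_mul_log_le {c g s L : ℝ} (hs : 0 < s) (hL : 0 ≤ L) (h : 4 * g ^ 2 ≤ s * exp L) :
    (c + g) ^ 2 * log ((c + g) ^ 2 / (c ^ 2 + s)) - (c + g) ^ 2 + (c ^ 2 + s)
      ≤ 15 * g ^ 2 + 3 * s + 4 * g ^ 2 * L := by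
  have ht : 0 < c ^ 2 + s := by positivity
  have hgL : 0 ≤ 4 * g ^ 2 * L := by positivity
  rcases le_total (g ^ 2) (c ^ 2 + s) with hg | hg
  · refine (mul_log_div_sub_add_le (sq_nonneg _) ht).trans ?_
    have : ((c + g) ^ 2 - (c ^ 2 + s)) ^ 2 / (c ^ 2 + s) ≤ 15 * g ^ 2 + 3 * s := by
      rw [div_le_iff₀ ht]
      have e : (c + g) ^ 2 - (c ^ 2 + s) = 2 * c * g + g ^ 2 - s := by ring
      rw [e]
      have h1 : (2 * c * g + g ^ 2 - s) ^ 2 ≤ 3 * ((2 * c * g) ^ 2 + (g ^ 2) ^ 2 + s ^ 2) := by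
        nlinarith [sq_nonneg (2 * c * g - g ^ 2), sq_nonneg (2 * c * g + s),
          sq_nonneg (g ^ 2 + s)]
      have h2 : (g ^ 2) ^ 2 ≤ (c ^ 2 + s) * g ^ 2 := by
        rw [sq (g ^ 2)]; gcongr
      have h3 : 0 ≤ c ^ 2 * s := by positivity
      have h4 : 0 ≤ g ^ 2 * s := by positivity
      nlinarith
    linarith
  · have hF : (c + g) ^ 2 ≤ 4 * g ^ 2 := by nlinarith [sq_nonneg (c - g)]
    have hlog : log ((c + g) ^ 2 / (c ^ 2 + s)) ≤ L := by
      rcases (sq_nonneg (c + g)).eq_or_lt with h0 | h0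
      · rw [← h0]; simpa using hL
      · rw [log_le_iff_le_exp (by positivity), div_le_iff₀ ht]
        calc (c + g) ^ 2 ≤ s * exp L := hF.trans h
          _ ≤ (c ^ 2 + s) * exp L := by gcongr; nlinarith [sq_nonneg c]
          _ = exp L * (c ^ 2 + s) := by ring
    have h1 : (c + g) ^ 2 * log ((c + g) ^ 2 / (c ^ 2 + s)) ≤ 4 * g ^ 2 * L :=
      (mul_le_mul_of_nonneg_left hlog (sq_nonneg _)).trans (by gcongr)
    nlinarith [sq_nonneg (c + g), sq_nonneg g]

lemma continuous_mul_log_div (t : ℝ) : Continuous fun x : ℝ => x * log (x / t) := by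
  rcases eq_or_ne t 0 with rfl | ht
  · simpa using continuous_const
  · have h : (fun x : ℝ => x * log (x / t)) = fun x => t * ((x / t) * log (x / t)) := by
      ext x; field_simp
    rw [h]
    exact continuous_const.mul (continuous_mul_log.comp (continuous_id.div_const t))

/-- The entropy is bounded by its variational expression at any level `t`. -/
lemma Ent_sq_le_integral {α : Type*} [MeasurableSpace α] {ν : Measure α}
    [IsProbabilityMeasure ν] {u : α → ℝ} (hu : AEStronglyMeasurable u ν) {B : ℝ}
    (hB : ∀ x, |u x| ≤ B) {t : ℝ} (ht : 0 < t) :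
    Ent ν (fun x => u x ^ 2) ≤ ∫ x, (u x ^ 2 * log (u x ^ 2 / t) - u x ^ 2 + t) ∂ν := by
  have hsq : Integrable (fun x => u x ^ 2) ν :=
    integrable_continuous_comp hu hB (continuous_pow 2)
  have hlog (r : ℝ) : Integrable (fun x => u x ^ 2 * log (u x ^ 2 / r)) ν :=
    integrable_continuous_comp hu hB ((continuous_mul_log_div r).comp (continuous_pow 2))
  unfold Ent
  set m := ∫ x, u x ^ 2 ∂ν with hm
  have hm0 : 0 ≤ m := integral_nonneg fun x => sq_nonneg _
  rcases hm0.eq_or_lt with h0 | hmpos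
  · simp only [← h0, div_zero, log_zero, mul_zero, integral_zero]
    exact integral_nonneg fun x => mul_log_div_sub_add_nonneg (sq_nonneg _) ht
  · have hsplit : ∀ x, u x ^ 2 * log (u x ^ 2 / m)
        = u x ^ 2 * log (u x ^ 2 / t) - u x ^ 2 * log (m / t) := by
      intro x
      rcases eq_or_ne (u x ^ 2) 0 with h | h
      · simp [h]
      · rw [log_div h hmpos.ne', log_div h ht.ne', log_div hmpos.ne' ht.ne']; ring
    have e1 : ∫ x, u x ^ 2 * log (u x ^ 2 / m) ∂ν
        = ∫ x, u x ^ 2 * log (u x ^ 2 / t) ∂ν - m * log (m / t) := by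
      simp_rw [hsplit]
      rw [integral_sub (hlog t) (hsq.mul_const _), integral_mul_const]
    have e2 : ∫ x, (u x ^ 2 * log (u x ^ 2 / t) - u x ^ 2 + t) ∂ν
        = ∫ x, u x ^ 2 * log (u x ^ 2 / t) ∂ν - m + t := by
      have h1 : Integrable (fun x => u x ^ 2 * log (u x ^ 2 / t) - u x ^ 2) ν := (hlog t).sub hsq
      rw [integral_add h1 (integrable_const _), integral_sub (hlog t) hsq]
      simp [hm]
    rw [e1, e2]
    linarith [mul_log_div_sub_add_nonneg hm0 ht]

/-- Integrated form of `sq_add_mul_log_le`. -/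
lemma Ent_sq_le_of_osc {α : Type*} [MeasurableSpace α] {ν : Measure α}
    [IsProbabilityMeasure ν] {u : α → ℝ} (hu : AEStronglyMeasurable u ν) {B : ℝ}
    (hB : ∀ x, |u x| ≤ B) (c : ℝ) {s : ℝ} (hs : 0 < s) {L : α → ℝ} (hL0 : ∀ x, 0 ≤ L x)
    (hL : ∀ᵐ x ∂ν, 4 * (u x - c) ^ 2 ≤ s * exp (L x))
    (hint : Integrable (fun x => (u x - c) ^ 2 * L x) ν) :
    Ent ν (fun x => u x ^ 2)
      ≤ 15 * ∫ x, (u x - c) ^ 2 ∂ν + 3 * s + 4 * ∫ x, (u x - c) ^ 2 * L x ∂ν := by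
  have ht : 0 < c ^ 2 + s := by positivity
  have hsq : Integrable (fun x => (u x - c) ^ 2) ν :=
    integrable_continuous_comp hu hB (φ := fun y => (y - c) ^ 2) (by fun_prop)
  have hF : Integrable (fun x => u x ^ 2 * log (u x ^ 2 / (c ^ 2 + s)) - u x ^ 2
      + (c ^ 2 + s)) ν :=
    integrable_continuous_comp hu hB
      (φ := fun y => y ^ 2 * log (y ^ 2 / (c ^ 2 + s)) - y ^ 2 + (c ^ 2 + s))
      ((((continuous_mul_log_div (c ^ 2 + s)).comp (continuous_pow 2)).sub
        (continuous_pow 2)).add continuous_const)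
  refine (Ent_sq_le_integral hu hB ht).trans ?_
  have hR1 : Integrable (fun x => 15 * (u x - c) ^ 2 + 3 * s) ν :=
    (hsq.const_mul 15).add (integrable_const _)
  have hR : Integrable (fun x => 15 * (u x - c) ^ 2 + 3 * s + 4 * ((u x - c) ^ 2 * L x)) ν :=
    hR1.add (hint.const_mul 4)
  refine (integral_mono_ae hF hR ?_).trans_eq ?_
  · filter_upwards [hL] with x hx
    have := sq_add_mul_log_le (c := c) hs (hL0 x) hx
    rw [add_sub_cancel] at this
    linarith
  · rw [integral_add hR1 (hint.const_mul 4),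
      integral_add (hsq.const_mul 15) (integrable_const _), integral_const_mul,
      integral_const_mul]
    simp [integral_const_mul]

/-- The standard Gaussian density. -/
local notation "φ₁" => gaussianPDFReal 0 1

lemma hasDerivAt_gaussianPDFReal_std (x : ℝ) : HasDerivAt φ₁ (-x * φ₁ x) x := by
  rw [gaussianPDFReal_def]
  have h : HasDerivAt (fun x : ℝ => -(x - 0) ^ 2 / (2 * ((1 : NNReal) : ℝ))) (-x) x := by
    have := ((((hasDerivAt_id x).sub_const 0).pow 2).neg).div_const (2 * ((1 : NNReal) : ℝ))
    exact this.congr_deriv (by simp; ring)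
  exact (h.exp.const_mul (√(2 * π * ((1 : NNReal) : ℝ)))⁻¹).congr_deriv (by ring)

lemma continuous_gaussianPDFReal_std : Continuous φ₁ :=
  continuous_iff_continuousAt.2 fun x => (hasDerivAt_gaussianPDFReal_std x).continuousAt

lemma hardy_pointwise {x g d : ℝ} (hx : 0 ≤ x) :
    4 * ((1 - 2 / (1 + x) ^ 2) - x * (x + 2 / (1 + x))) * g ^ 2
      + 8 * (x + 2 / (1 + x)) * g * d ≤ 80 * d ^ 2 - (1 + x ^ 2) * g ^ 2 := by
  have h1 : 0 < 1 + x := by linarith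
  obtain ⟨w, hw⟩ : ∃ w, w = 1 / (1 + x) := ⟨_, rfl⟩
  have hw0 : 0 ≤ w := by rw [hw]; positivity
  have hw1 : w ≤ 1 := by rw [hw, div_le_one h1]; linarith
  have hxw : x * w = 1 - w := by rw [hw]; field_simp; ring
  have e1 : 2 / (1 + x) ^ 2 = 2 * w ^ 2 := by rw [hw]; field_simp
  have e2 : 2 / (1 + x) = 2 * w := by rw [hw]; field_simp
  rw [e1, e2]
  have key : x * (x + 2 * w) - (1 - 2 * w ^ 2) ≥ (1 + x ^ 2) / 2 := by
    nlinarith [sq_nonneg (2 * w - 1), sq_nonneg x]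
  have hh : (x + 2 * w) ^ 2 ≤ 5 * (1 + x ^ 2) := by
    nlinarith [sq_nonneg (2 * x - 1)]
  have hsq : 8 * (x + 2 * w) * g * d ≤ 80 * d ^ 2 + (x + 2 * w) ^ 2 * g ^ 2 / 5 := by
    nlinarith [sq_nonneg (20 * d - (x + 2 * w) * g)]
  have k1 := mul_le_mul_of_nonneg_right key (sq_nonneg g)
  have k2 := mul_le_mul_of_nonneg_right hh (sq_nonneg g)
  nlinarith

lemma hardy_half_line {u : ℝ → ℝ} (hu : ContDiff ℝ 1 u) {ℓ : ℝ} (hℓ : 0 ≤ ℓ) :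
    0 ≤ ∫ x in (0 : ℝ)..ℓ, φ₁ x * (80 * deriv u x ^ 2 - (1 + x ^ 2) * (u x - u 0) ^ 2) := by
  have hud : ∀ x, HasDerivAt u (deriv u x) x := fun x =>
    ((hu.differentiable one_ne_zero) x).hasDerivAt
  have hdc : Continuous (deriv u) := hu.continuous_deriv le_rfl
  have hφ := continuous_gaussianPDFReal_std
  have huc := hu.continuous
  let Ψ : ℝ → ℝ := fun x => 4 * (x + 2 / (1 + x)) * φ₁ x * (u x - u 0) ^ 2
  let Ψ' : ℝ → ℝ := fun x => φ₁ x * (4 * ((1 - 2 / (1 + x) ^ 2) - x * (x + 2 / (1 + x)))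
    * (u x - u 0) ^ 2 + 8 * (x + 2 / (1 + x)) * (u x - u 0) * deriv u x)
  have hder : ∀ x, 0 ≤ x → HasDerivAt Ψ (Ψ' x) x := by
    intro x hx
    have h1 : (1 + x) ≠ 0 := by positivity
    have d1 : HasDerivAt (fun x : ℝ => x + 2 / (1 + x)) (1 - 2 / (1 + x) ^ 2) x := by
      have := (hasDerivAt_id x).add
        ((hasDerivAt_const x (2 : ℝ)).div ((hasDerivAt_id x).const_add 1) h1)
      exact this.congr_deriv (by simp; ring)
    have d2 := ((d1.const_mul 4).mul (hasDerivAt_gaussianPDFReal_std x)).mul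
      (((hud x).sub_const (u 0)).pow 2)
    refine d2.congr_deriv ?_
    simp only [Ψ', Nat.cast_ofNat, Pi.pow_apply, Pi.mul_apply]
    ring
  have h := intervalIntegral.sub_le_integral_of_hasDeriv_right_of_le hℓ
    (g := Ψ) (g' := Ψ')
    (φ := fun x => φ₁ x * (80 * deriv u x ^ 2 - (1 + x ^ 2) * (u x - u 0) ^ 2))
    (fun x hx => (hder x hx.1).continuousAt.continuousWithinAt)
    (fun x hx => (hder x hx.1.le).hasDerivWithinAt)
    ((by fun_prop : Continuous _).integrableOn_Icc)
    (fun x hx => mul_le_mul_of_nonneg_left (hardy_pointwise hx.1.le)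
      (gaussianPDFReal_nonneg 0 1 x))
  have h0 : Ψ 0 = 0 := by simp [Ψ]
  have hl : 0 ≤ Ψ ℓ := by
    have := gaussianPDFReal_nonneg 0 1 ℓ
    simp only [Ψ]; positivity
  linarith

lemma gaussianPDFReal_std_neg (x : ℝ) : φ₁ (-x) = φ₁ x := by
  simp [gaussianPDFReal_def]

lemma integrable_std_gaussian_iff {F : ℝ → ℝ} :
    Integrable F (gaussianReal 0 1) ↔ Integrable (fun x => φ₁ x * F x) := by
  rw [gaussianReal_of_var_ne_zero 0 one_ne_zero,
    integrable_withDensity_iff_integrable_smul' (measurable_gaussianPDF 0 1)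
      (Filter.Eventually.of_forall fun _ => gaussianPDF_lt_top)]
  simp [toReal_gaussianPDF]

lemma integral_std_gaussian (F : ℝ → ℝ) :
    ∫ x, F x ∂(gaussianReal 0 1) = ∫ x, φ₁ x * F x := by
  simp [integral_gaussianReal_eq_integral_smul (one_ne_zero)]

lemma exists_abs_le_of_hasCompactSupport {u : ℝ → ℝ} (hu : Continuous u)
    (hc : HasCompactSupport u) : ∃ B, ∀ x, |u x| ≤ B :=
  hu.bounded_above_of_compact_support hc

lemma integrable_one_add_sq_mul {u : ℝ → ℝ} (hu : Continuous u) (hc : HasCompactSupport u)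
    (c : ℝ) : Integrable (fun x => (u x - c) ^ 2 * (1 + x ^ 2)) (gaussianReal 0 1) := by
  obtain ⟨B, hB⟩ := exists_abs_le_of_hasCompactSupport hu hc
  have h2 : Integrable (fun x : ℝ => 1 + x ^ 2) (gaussianReal 0 1) :=
    (integrable_const _).add (memLp_id_gaussianReal 2).integrable_sq
  refine h2.bdd_mul (c := (B + |c|) ^ 2) (by fun_prop) (Filter.Eventually.of_forall fun x => ?_)
  rw [norm_pow]
  exact pow_le_pow_left₀ (norm_nonneg _) ((norm_sub_le _ _).trans (by
    simpa using hB x)) 2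

/-- A weighted Hardy inequality for the standard Gaussian measure. -/
lemma gaussian_hardy {u : ℝ → ℝ} (hu : ContDiff ℝ 1 u) (hc : HasCompactSupport u) :
    ∫ x, (u x - u 0) ^ 2 * (1 + x ^ 2) ∂(gaussianReal 0 1)
      ≤ 80 * ∫ x, deriv u x ^ 2 ∂(gaussianReal 0 1) := by
  have hdc : Continuous (deriv u) := hu.continuous_deriv le_rfl
  have hφ := continuous_gaussianPDFReal_std
  have huc := hu.continuous
  obtain ⟨B, hB⟩ := exists_abs_le_of_hasCompactSupport hdc hc.deriv
  have i1 : Integrable (fun x => deriv u x ^ 2) (gaussianReal 0 1) :=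
    integrable_continuous_comp hdc.aestronglyMeasurable hB (continuous_pow 2)
  have i2 := integrable_one_add_sq_mul huc hc (u 0)
  let Θ : ℝ → ℝ := fun x => φ₁ x * (80 * deriv u x ^ 2 - (1 + x ^ 2) * (u x - u 0) ^ 2)
  have hΘc : Continuous Θ := by fun_prop
  have hΘ : Integrable Θ := by
    have := integrable_std_gaussian_iff.1 ((i1.const_mul 80).sub i2)
    refine this.congr (Filter.Eventually.of_forall fun x => ?_)
    simp only [Θ, Pi.sub_apply]; ring
  have hpos : ∀ ℓ : ℝ, 0 ≤ ℓ → 0 ≤ ∫ x in (-ℓ)..ℓ, Θ x := by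
    intro ℓ hℓ
    rw [← intervalIntegral.integral_add_adjacent_intervals (b := 0)
      (hΘc.intervalIntegrable _ _) (hΘc.intervalIntegrable _ _)]
    refine add_nonneg ?_ (hardy_half_line hu hℓ)
    have h := hardy_half_line (u := fun x => u (-x)) (hu.comp contDiff_neg) hℓ
    have e : ∀ x, φ₁ x * (80 * deriv (fun x => u (-x)) x ^ 2
        - (1 + x ^ 2) * (u (-x) - u (-0)) ^ 2) = Θ (-x) := by
      intro x
      simp only [Θ, deriv_comp_neg, gaussianPDFReal_std_neg, neg_zero]
      ring
    simp_rw [e] at h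
    rw [intervalIntegral.integral_comp_neg] at h
    simpa using h
  have hlim := intervalIntegral_tendsto_integral hΘ Filter.tendsto_neg_atTop_atBot
    Filter.tendsto_id
  have h0 : 0 ≤ ∫ x, Θ x := ge_of_tendsto hlim (by
    filter_upwards [Filter.eventually_ge_atTop 0] with ℓ hℓ using hpos ℓ hℓ)
  have e : ∫ x, Θ x = 80 * ∫ x, deriv u x ^ 2 ∂(gaussianReal 0 1)
      - ∫ x, (u x - u 0) ^ 2 * (1 + x ^ 2) ∂(gaussianReal 0 1) := by
    rw [← integral_const_mul, ← integral_sub (i1.const_mul 80) i2, integral_std_gaussian]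
    refine integral_congr_ae (Filter.Eventually.of_forall fun x => ?_)
    simp only [Θ]; ring
  linarith

lemma inv_gaussianPDFReal_std_le {t x : ℝ} (h : |t| ≤ |x|) :
    (φ₁ t)⁻¹ ≤ 3 * exp (x ^ 2 / 2) := by
  have h1 : (φ₁ t)⁻¹ = √(2 * π) * exp (t ^ 2 / 2) := by
    simp only [gaussianPDFReal_def, NNReal.coe_one, mul_one, sub_zero, mul_inv, inv_inv]
    rw [← exp_neg]; congr 2; ring
  have h2 : √(2 * π) ≤ 3 := by
    rw [sqrt_le_left (by norm_num)]; linarith [pi_lt_d2]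
  have h3 : t ^ 2 ≤ x ^ 2 := sq_le_sq.2 h
  rw [h1]
  exact mul_le_mul h2 (exp_le_exp.2 (by linarith)) (exp_pos _).le (by norm_num)

/-- A function vanishing at the origin is controlled pointwise by its Gaussian energy. -/
lemma gaussian_growth {u : ℝ → ℝ} (hu : ContDiff ℝ 1 u) (hc : HasCompactSupport u) {s : ℝ}
    (hs : 0 < s) (hE : ∫ x, deriv u x ^ 2 ∂(gaussianReal 0 1) ≤ s) (x : ℝ) :
    4 * (u x - u 0) ^ 2 ≤ s * exp (3 * (1 + x ^ 2)) := by
  have hdc : Continuous (deriv u) := hu.continuous_deriv le_rfl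
  have hφ := continuous_gaussianPDFReal_std
  obtain ⟨B, hB⟩ := exists_abs_le_of_hasCompactSupport hdc hc.deriv
  have i1 : Integrable (fun x => φ₁ x * deriv u x ^ 2) :=
    integrable_std_gaussian_iff.1
      (integrable_continuous_comp hdc.aestronglyMeasurable hB (continuous_pow 2))
  obtain ⟨k, hk, rfl⟩ : ∃ k, 0 < k ∧ s = k ^ 2 :=
    ⟨√s, sqrt_pos.2 hs, (sq_sqrt hs.le).symm⟩
  rw [integral_std_gaussian] at hE
  have hftc : u x - u 0 = ∫ t in (0 : ℝ)..x, deriv u t :=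
    (intervalIntegral.integral_deriv_eq_sub
      (fun t _ => (hu.differentiable one_ne_zero) t) (hdc.intervalIntegrable _ _)).symm
  have hvol : volume (Set.uIoc 0 x) ≠ ⊤ := by
    rw [Set.uIoc, Real.volume_Ioc]; exact ENNReal.ofReal_ne_top
  have i2 : IntegrableOn (fun t => φ₁ t * deriv u t ^ 2 / (2 * k)) (Set.uIoc 0 x) :=
    (i1.div_const _).integrableOn
  have i3 : IntegrableOn (fun _ : ℝ => k * (3 * exp (x ^ 2 / 2)) / 2) (Set.uIoc 0 x) :=
    integrableOn_const hvol
  have hbound : |u x - u 0| ≤ ∫ t in Set.uIoc 0 x,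
      (φ₁ t * deriv u t ^ 2 / (2 * k) + k * (3 * exp (x ^ 2 / 2)) / 2) := by
    rw [hftc, ← Real.norm_eq_abs]
    refine intervalIntegral.norm_integral_le_integral_norm_uIoc.trans ?_
    refine setIntegral_mono_on ?_ (i2.add i3) measurableSet_uIoc ?_
    · exact (hdc.norm.intervalIntegrable 0 x).def'
    · intro t ht
      have hp : 0 < φ₁ t := gaussianPDFReal_pos 0 1 t one_ne_zero
      have htx : |t| ≤ |x| := by
        rcases Set.mem_uIoc.1 ht with h | h
        · rw [abs_of_pos h.1, abs_of_pos (h.1.trans_le h.2)]; exact h.2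
        · rw [abs_of_nonpos h.2, abs_of_neg (h.1.trans_le h.2)]; linarith
      have h1 := inv_gaussianPDFReal_std_le htx
      have h2 : k * (φ₁ t)⁻¹ / 2 ≤ k * (3 * exp (x ^ 2 / 2)) / 2 := by gcongr
      refine le_trans ?_ (add_le_add_right h2 _)
      rw [Real.norm_eq_abs, ← sq_abs (deriv u t)]
      have h3 : φ₁ t * |deriv u t| ^ 2 / (2 * k) + k * (φ₁ t)⁻¹ / 2 - |deriv u t|
          = (φ₁ t * |deriv u t| - k) ^ 2 / (2 * k * φ₁ t) := by
        field_simp; ring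
      have h4 : 0 ≤ (φ₁ t * |deriv u t| - k) ^ 2 / (2 * k * φ₁ t) := by positivity
      linarith
  have hA : ∫ t in Set.uIoc 0 x, φ₁ t * deriv u t ^ 2 / (2 * k) ≤ k / 2 := by
    rw [integral_div]
    have h1 : ∫ t in Set.uIoc 0 x, φ₁ t * deriv u t ^ 2 ≤ ∫ t, φ₁ t * deriv u t ^ 2 :=
      setIntegral_le_integral i1 (Filter.Eventually.of_forall fun t =>
        mul_nonneg (gaussianPDFReal_nonneg 0 1 t) (sq_nonneg _))
    rw [div_le_iff₀ (by positivity)]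
    nlinarith
  have hvr : volume.real (Set.uIoc 0 x) = |x| := by
    rw [Set.uIoc, Real.volume_real_Ioc_of_le (by simp), max_sub_min_eq_abs]; simp
  rw [integral_add i2 i3, setIntegral_const, hvr, smul_eq_mul] at hbound
  have he : |x| ≤ exp (x ^ 2 / 2) := by
    have := add_one_le_exp (x ^ 2 / 2)
    nlinarith [sq_nonneg (|x| - 1), sq_abs x]
  have he1 : 1 ≤ exp (x ^ 2 / 2) := one_le_exp (by positivity)
  have hfin : |u x - u 0| ≤ 2 * k * exp (x ^ 2 / 2) ^ 2 := by
    have h5 : |x| * exp (x ^ 2 / 2) ≤ exp (x ^ 2 / 2) ^ 2 :=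
      (mul_le_mul_of_nonneg_right he (exp_pos _).le).trans_eq (sq _).symm
    have h6 : 1 ≤ exp (x ^ 2 / 2) ^ 2 := one_le_pow₀ he1
    have h7 := mul_le_mul_of_nonneg_left h5 hk.le
    have h8 := mul_le_mul_of_nonneg_left h6 hk.le
    nlinarith
  have hexp : exp (3 * (1 + x ^ 2)) = exp 1 ^ 3 * exp (x ^ 2 / 2) ^ 6 := by
    rw [← exp_nat_mul, ← exp_nat_mul, ← exp_add]; congr 1; push_cast; ring
  have h16 : 16 ≤ exp 1 ^ 3 := by
    have h := pow_le_pow_left₀ (by norm_num) exp_one_gt_d9.le 3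
    norm_num at h ⊢; linarith
  calc 4 * (u x - u 0) ^ 2 = 4 * |u x - u 0| ^ 2 := by rw [sq_abs]
    _ ≤ 4 * (2 * k * exp (x ^ 2 / 2) ^ 2) ^ 2 := by gcongr
    _ = k ^ 2 * (16 * exp (x ^ 2 / 2) ^ 4) := by ring
    _ ≤ k ^ 2 * (exp 1 ^ 3 * exp (x ^ 2 / 2) ^ 6) :=
      mul_le_mul_of_nonneg_left (mul_le_mul h16 (pow_le_pow_right₀ he1 (by norm_num))
        (by positivity) (by positivity)) (by positivity)
    _ = k ^ 2 * exp (3 * (1 + x ^ 2)) := by rw [hexp]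

/-- A logarithmic Sobolev inequality for the standard Gaussian measure, with a non-optimal
constant. -/
lemma gaussian_lsi {u : ℝ → ℝ} (hu : ContDiff ℝ 1 u) (hc : HasCompactSupport u) :
    Ent (gaussianReal 0 1) (fun x => u x ^ 2)
      ≤ 2163 * ∫ x, deriv u x ^ 2 ∂(gaussianReal 0 1) := by
  have huc := hu.continuous
  obtain ⟨B, hB⟩ := exists_abs_le_of_hasCompactSupport huc hc
  have hE0 : 0 ≤ ∫ x, deriv u x ^ 2 ∂(gaussianReal 0 1) := integral_nonneg fun x => sq_nonneg _
  have hH := gaussian_hardy hu hc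
  set E := ∫ x, deriv u x ^ 2 ∂(gaussianReal 0 1) with hE
  have i2 := integrable_one_add_sq_mul huc hc (u 0)
  have hcomm (x : ℝ) : (u x - u 0) ^ 2 * (3 * (1 + x ^ 2))
      = 3 * ((u x - u 0) ^ 2 * (1 + x ^ 2)) := by ring
  refine le_of_forall_pos_le_add fun ε hε => ?_
  have h := Ent_sq_le_of_osc (ν := gaussianReal 0 1) huc.aestronglyMeasurable hB (u 0)
    (s := E + ε / 3) (L := fun x => 3 * (1 + x ^ 2)) (by positivity)
    (fun x => by positivity)
    (Filter.Eventually.of_forall (gaussian_growth hu hc (by positivity) (by linarith)))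
    (by simp_rw [hcomm]; exact i2.const_mul 3)
  simp_rw [hcomm] at h
  rw [integral_const_mul] at h
  have h1 : ∫ x, (u x - u 0) ^ 2 ∂(gaussianReal 0 1)
      ≤ ∫ x, (u x - u 0) ^ 2 * (1 + x ^ 2) ∂(gaussianReal 0 1) :=
    integral_mono (integrable_continuous_comp huc.aestronglyMeasurable hB
      (φ := fun y => (y - u 0) ^ 2) (by fun_prop)) i2
      fun x => by nlinarith [mul_nonneg (sq_nonneg (u x - u 0)) (sq_nonneg x)]
  linarith

lemma exists_sq_le_of_hasCompactSupport {u : ℝ → ℝ} (hu : Continuous u)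
    (hc : HasCompactSupport u) : ∃ B, ∀ x, |u x ^ 2| ≤ B := by
  obtain ⟨B, hB⟩ := exists_abs_le_of_hasCompactSupport hu hc
  exact ⟨B ^ 2, fun x => by rw [abs_pow]; exact pow_le_pow_left₀ (abs_nonneg _) (hB x) 2⟩

/-- The average of `Φ` against the Gaussian measure centered at `y` with standard
deviation `σ`. -/
noncomputable def gaussianAverage (σ : ℝ) (Φ : ℝ → ℝ) (y : ℝ) : ℝ :=
  ∫ z, Φ (y + σ * z) ∂(gaussianReal 0 1)

lemma continuous_gaussianAverage {σ : ℝ} {Φ : ℝ → ℝ} (hΦ : Continuous Φ) {B : ℝ}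
    (hB : ∀ x, |Φ x| ≤ B) : Continuous (gaussianAverage σ Φ) :=
  continuous_of_dominated (bound := fun _ => B)
    (fun y => (by fun_prop : Continuous fun z => Φ (y + σ * z)).aestronglyMeasurable)
    (fun y => Filter.Eventually.of_forall fun z => hB _) (integrable_const _)
    (Filter.Eventually.of_forall fun z => by fun_prop)

lemma abs_gaussianAverage_le {σ : ℝ} {Φ : ℝ → ℝ} {B : ℝ} (hB : ∀ x, |Φ x| ≤ B) (y : ℝ) :
    |gaussianAverage σ Φ y| ≤ B := by
  have := norm_integral_le_of_norm_le_const (μ := gaussianReal 0 1)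
    (f := fun z => Φ (y + σ * z)) (C := B) (Filter.Eventually.of_forall fun z => hB (y + σ * z))
  simpa [gaussianAverage] using this

lemma integrable_comp_gaussian {σ : ℝ} {Φ : ℝ → ℝ} (hΦ : Continuous Φ) {B : ℝ}
    (hB : ∀ x, |Φ x| ≤ B) (y : ℝ) :
    Integrable (fun z => Φ (y + σ * z)) (gaussianReal 0 1) :=
  Integrable.of_bound (by fun_prop : Continuous fun z => Φ (y + σ * z)).aestronglyMeasurable B
    (Filter.Eventually.of_forall fun z => hB _)

lemma integrable_gaussianAverage {μ : Measure ℝ} [IsFiniteMeasure μ] {σ : ℝ} {Φ : ℝ → ℝ}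
    (hΦ : Continuous Φ) {B : ℝ} (hB : ∀ x, |Φ x| ≤ B) : Integrable (gaussianAverage σ Φ) μ :=
  Integrable.of_bound (continuous_gaussianAverage hΦ hB).aestronglyMeasurable B
    (Filter.Eventually.of_forall fun y => abs_gaussianAverage_le hB y)

lemma gaussianMeasure_eq_map {δ : ℝ} (hδ : 0 < δ) :
    gaussianMeasure δ = (gaussianReal 0 1).map (√δ * ·) := by
  have hv : NNReal.mk (√δ ^ 2) (sq_nonneg _) * 1 ≠ 0 := by
    rw [mul_one]
    exact fun h => (pow_pos (sqrt_pos.2 hδ) 2).ne' (congrArg NNReal.toReal h)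
  rw [gaussianReal_map_const_mul, gaussianReal_of_var_ne_zero _ hv, gaussianMeasure]
  congr 1
  ext t
  simp [gaussianPDF, gaussianPDFReal, sq_sqrt hδ.le]

lemma integral_mconv_gaussianMeasure {μ : Measure ℝ} [IsProbabilityMeasure μ] {δ : ℝ}
    (hδ : 0 < δ) {Φ : ℝ → ℝ} (hΦ : Continuous Φ) {B : ℝ} (hB : ∀ x, |Φ x| ≤ B) :
    ∫ x, Φ x ∂(mconv μ (gaussianMeasure δ)) = ∫ y, gaussianAverage (√δ) Φ y ∂μ := by
  have hm : Measurable (√δ * · : ℝ → ℝ) := by fun_prop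
  have : IsProbabilityMeasure ((gaussianReal 0 1).map (√δ * ·)) :=
    Measure.isProbabilityMeasure_map hm.aemeasurable
  rw [mconv, gaussianMeasure_eq_map hδ, integral_map (by fun_prop) hΦ.aestronglyMeasurable,
    integral_prod]
  · refine integral_congr_ae (Filter.Eventually.of_forall fun y => ?_)
    exact integral_map hm.aemeasurable
      (by fun_prop : Continuous fun z => Φ (y + z)).aestronglyMeasurable
  · exact Integrable.of_bound
      (by fun_prop : Continuous fun p : ℝ × ℝ => Φ (p.1 + p.2)).aestronglyMeasurable B
      (Filter.Eventually.of_forall fun z => hB _)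

lemma sq_intervalIntegral_le {h : ℝ → ℝ} (hh : Continuous h) {x y : ℝ} (hxy : y ≤ x) :
    (∫ t in y..x, h t) ^ 2 ≤ (x - y) * ∫ t in y..x, h t ^ 2 := by
  rcases hxy.eq_or_lt with rfl | hlt
  · simp
  have hpos : 0 < x - y := sub_pos.2 hlt
  set I := ∫ t in y..x, h t with hI
  have h0 : 0 ≤ ∫ t in y..x, ((x - y) * h t - I) ^ 2 :=
    intervalIntegral.integral_nonneg hxy fun t _ => sq_nonneg _
  have e : ∫ t in y..x, ((x - y) * h t - I) ^ 2
      = (x - y) ^ 2 * (∫ t in y..x, h t ^ 2) - 2 * (x - y) * I * I + (x - y) * I ^ 2 := by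
    have e1 : ∀ t, ((x - y) * h t - I) ^ 2
        = ((x - y) ^ 2 * h t ^ 2 - 2 * (x - y) * I * h t) + I ^ 2 := fun t => by ring
    simp_rw [e1]
    rw [intervalIntegral.integral_add, intervalIntegral.integral_sub,
      intervalIntegral.integral_const_mul, intervalIntegral.integral_const_mul,
      intervalIntegral.integral_const, smul_eq_mul]
    all_goals exact (by fun_prop : Continuous _).intervalIntegrable _ _
  rw [e] at h0
  have h1 : 0 ≤ (x - y) * ((x - y) * (∫ t in y..x, h t ^ 2) - I ^ 2) := by nlinarith
  linarith [nonneg_of_mul_nonneg_right h1 hpos]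

lemma sq_sub_le_integral_deriv_sq {f : ℝ → ℝ} (hf : ContDiff ℝ 1 f) {R x y : ℝ}
    (hx : x ∈ Set.Icc (-R) R) (hy : y ∈ Set.Icc (-R) R) (w : ℝ) :
    (f (x + w) - f (y + w)) ^ 2
      ≤ 2 * R * ∫ t in Set.Icc (-R) R, deriv f (t + w) ^ 2 := by
  wlog hxy : y ≤ x generalizing x y
  · have := this hy hx (le_of_not_ge hxy)
    nlinarith
  have hdc : Continuous (deriv f) := hf.continuous_deriv le_rfl
  have hc : Continuous fun t => deriv f (t + w) := by fun_prop
  have hftc : f (x + w) - f (y + w) = ∫ t in y..x, deriv f (t + w) := by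
    rw [intervalIntegral.integral_comp_add_right (deriv f) w]
    exact (intervalIntegral.integral_deriv_eq_sub
      (fun t _ => (hf.differentiable one_ne_zero) t) (hdc.intervalIntegrable _ _)).symm
  rw [hftc]
  refine (sq_intervalIntegral_le hc hxy).trans ?_
  rw [intervalIntegral.integral_of_le hxy]
  refine mul_le_mul (by linarith [hx.2, hy.1]) ?_ (integral_nonneg fun t => sq_nonneg _)
    (by linarith [hx.1, hx.2])
  exact setIntegral_mono_set (hc.pow 2).integrableOn_Icc
    (Filter.Eventually.of_forall fun t => sq_nonneg _)
    (LE.le.eventuallyLE fun t ht => ⟨hy.1.trans ht.1.le, ht.2.trans hx.2⟩)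

/-- The reverse triangle inequality in `L²`. -/
lemma sq_sqrt_sub_sqrt_le {α : Type*} [MeasurableSpace α] {ν : Measure α} {p q : α → ℝ}
    (hp : Integrable (fun x => p x ^ 2) ν) (hq : Integrable (fun x => q x ^ 2) ν)
    (hpq : Integrable (fun x => p x * q x) ν) (hp0 : 0 < ∫ x, p x ^ 2 ∂ν)
    (hq0 : 0 < ∫ x, q x ^ 2 ∂ν) :
    (√(∫ x, p x ^ 2 ∂ν) - √(∫ x, q x ^ 2 ∂ν)) ^ 2 ≤ ∫ x, (p x - q x) ^ 2 ∂ν := by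
  set A := ∫ x, p x ^ 2 ∂ν
  set B := ∫ x, q x ^ 2 ∂ν
  have hk : 0 < √A := sqrt_pos.2 hp0
  have hl : 0 < √B := sqrt_pos.2 hq0
  have hA : √A ^ 2 = A := sq_sqrt hp0.le
  have hB : √B ^ 2 = B := sq_sqrt hq0.le
  have h1 : ∫ x, p x * q x ∂ν ≤ ∫ x, (√B / √A / 2 * p x ^ 2 + √A / √B / 2 * q x ^ 2) ∂ν := by
    refine integral_mono hpq ((hp.const_mul _).add (hq.const_mul _)) fun x => ?_
    have e : √B / √A / 2 * p x ^ 2 + √A / √B / 2 * q x ^ 2 - p x * q x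
        = (√B * p x - √A * q x) ^ 2 / (2 * √A * √B) := by field_simp; ring
    have : 0 ≤ (√B * p x - √A * q x) ^ 2 / (2 * √A * √B) := by positivity
    dsimp only
    linarith
  have h2 : ∫ x, (√B / √A / 2 * p x ^ 2 + √A / √B / 2 * q x ^ 2) ∂ν = √A * √B := by
    rw [integral_add (hp.const_mul _) (hq.const_mul _), integral_const_mul, integral_const_mul]
    change √B / √A / 2 * A + √A / √B / 2 * B = _
    calc √B / √A / 2 * A + √A / √B / 2 * B
        = √B / √A / 2 * √A ^ 2 + √A / √B / 2 * √B ^ 2 := by rw [hA, hB]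
      _ = √A * √B := by field_simp; ring
  have h3 : ∫ x, (p x - q x) ^ 2 ∂ν = A + B - 2 * ∫ x, p x * q x ∂ν := by
    have e : ∀ x, (p x - q x) ^ 2 = (p x ^ 2 + q x ^ 2) - 2 * (p x * q x) := fun x => by ring
    simp_rw [e]
    have hs : Integrable (fun x => p x ^ 2 + q x ^ 2) ν := hp.add hq
    rw [integral_sub hs (hpq.const_mul 2), integral_add hp hq, integral_const_mul]
  rw [h3]
  nlinarith

lemma mul_setIntegral_le_of_density {R a : ℝ} (ha : 0 < a) {μ : Measure ℝ}
    (hdens : ∀ A : Set ℝ, MeasurableSet A →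
      ENNReal.ofReal a * volume (A ∩ Set.Icc (-R) R) ≤ μ A)
    {H : ℝ → ℝ} (hH0 : ∀ x, 0 ≤ H x) (hH : Integrable H μ) :
    a * ∫ t in Set.Icc (-R) R, H t ≤ ∫ t, H t ∂μ := by
  have hle : ENNReal.ofReal a • volume.restrict (Set.Icc (-R) R) ≤ μ := by
    refine Measure.le_iff.2 fun s hs => ?_
    rw [Measure.smul_apply, Measure.restrict_apply hs, smul_eq_mul]
    exact hdens s hs
  have := integral_mono_measure hle (Filter.Eventually.of_forall hH0) hH
  rwa [integral_smul_measure, ENNReal.toReal_ofReal ha.le, smul_eq_mul] at this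

lemma gaussianAverage_sq_pos {σ : ℝ} (hσ : 0 < σ) {f : ℝ → ℝ} (hf : Continuous f) {B : ℝ}
    (hB : ∀ x, |f x ^ 2| ≤ B) {x₀ : ℝ} (h0 : f x₀ ≠ 0) (y : ℝ) :
    0 < gaussianAverage σ (fun x => f x ^ 2) y := by
  have hc : Continuous fun z => f (y + σ * z) ^ 2 := by fun_prop
  refine (integral_nonneg fun z => sq_nonneg _).lt_of_ne fun h => h0 ?_
  have hae := (integral_eq_zero_iff_of_nonneg (fun z => sq_nonneg (f (y + σ * z)))
    (integrable_comp_gaussian (hf.pow 2) hB y)).1 h.symm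
  have hvol := (gaussianReal_absolutelyContinuous' 0 one_ne_zero).ae_eq hae
  have heq := (hc.ae_eq_iff_eq volume continuous_zero).1 hvol
  have := congrFun heq ((x₀ - y) / σ)
  have e : y + σ * ((x₀ - y) / σ) = x₀ := by field_simp; ring
  simpa [e] using this

lemma sq_sqrt_gaussianAverage_sub_le {R a : ℝ} (hR : 0 < R) (ha : 0 < a) {μ : Measure ℝ}
    [IsProbabilityMeasure μ]
    (hdens : ∀ A : Set ℝ, MeasurableSet A →
      ENNReal.ofReal a * volume (A ∩ Set.Icc (-R) R) ≤ μ A)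
    {σ : ℝ} (hσ : 0 < σ) {f : ℝ → ℝ} (hf : ContDiff ℝ 1 f) (hc : HasCompactSupport f)
    {x₀ : ℝ} (h0 : f x₀ ≠ 0) {x y : ℝ} (hx : x ∈ Set.Icc (-R) R) (hy : y ∈ Set.Icc (-R) R) :
    (√(gaussianAverage σ (fun x => f x ^ 2) x) - √(gaussianAverage σ (fun x => f x ^ 2) y)) ^ 2
      ≤ 2 * (R / a) * ∫ t, gaussianAverage σ (fun x => deriv f x ^ 2) t ∂μ := by
  have hfc := hf.continuous
  have hdc : Continuous (deriv f) := hf.continuous_deriv le_rfl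
  obtain ⟨B, hB⟩ := exists_sq_le_of_hasCompactSupport hfc hc
  obtain ⟨D, hD⟩ := exists_sq_le_of_hasCompactSupport hdc hc.deriv
  have hp (y : ℝ) : Integrable (fun z => f (y + σ * z) ^ 2) (gaussianReal 0 1) :=
    integrable_comp_gaussian (hfc.pow 2) hB y
  have hmem (y : ℝ) : MemLp (fun z => f (y + σ * z)) 2 (gaussianReal 0 1) :=
    (memLp_two_iff_integrable_sq
      (by fun_prop : Continuous fun z => f (y + σ * z)).aestronglyMeasurable).2 (hp y)
  have hprod : Integrable (Function.uncurry fun z t => deriv f (t + σ * z) ^ 2)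
      ((gaussianReal 0 1).prod (volume.restrict (Set.Icc (-R) R))) :=
    Integrable.of_bound
      (by fun_prop : Continuous fun p : ℝ × ℝ => deriv f (p.2 + σ * p.1) ^ 2).aestronglyMeasurable
      D (Filter.Eventually.of_forall fun p => hD _)
  calc _ ≤ ∫ z, (f (x + σ * z) - f (y + σ * z)) ^ 2 ∂(gaussianReal 0 1) :=
        sq_sqrt_sub_sqrt_le (hp x) (hp y) ((hmem x).integrable_mul (hmem y))
          (gaussianAverage_sq_pos hσ hfc hB h0 x) (gaussianAverage_sq_pos hσ hfc hB h0 y)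
    _ ≤ ∫ z, 2 * R * (∫ t in Set.Icc (-R) R, deriv f (t + σ * z) ^ 2) ∂(gaussianReal 0 1) :=
        integral_mono ((hmem x).sub (hmem y)).integrable_sq
          (hprod.integral_prod_left.const_mul _)
          fun z => sq_sub_le_integral_deriv_sq hf hx hy (σ * z)
    _ = 2 * R * ∫ t in Set.Icc (-R) R, gaussianAverage σ (fun x => deriv f x ^ 2) t := by
        rw [integral_const_mul, integral_integral_swap hprod]; rfl
    _ = 2 * (R / a) * (a * ∫ t in Set.Icc (-R) R,
          gaussianAverage σ (fun x => deriv f x ^ 2) t) := by field_simp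
    _ ≤ _ := by
        gcongr
        exact mul_setIntegral_le_of_density ha hdens
          (fun t => integral_nonneg fun z => sq_nonneg _)
          (integrable_gaussianAverage (hdc.pow 2) hD)

/-- Tensorization: the entropy for `μ * γ` splits into Gaussian entropies and an entropy for
`μ`. -/
lemma integral_gaussianAverage_entropy_le {μ : Measure ℝ} [IsProbabilityMeasure μ] {σ : ℝ}
    (hσ : 0 < σ) {f : ℝ → ℝ} (hf : ContDiff ℝ 1 f) (hc : HasCompactSupport f)
    {x₀ : ℝ} (h0 : f x₀ ≠ 0) {m : ℝ}
    (hm : m = ∫ y, gaussianAverage σ (fun x => f x ^ 2) y ∂μ) :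
    ∫ y, gaussianAverage σ (fun x => f x ^ 2 * log (f x ^ 2 / m)) y ∂μ
      ≤ 2163 * σ ^ 2 * ∫ y, gaussianAverage σ (fun x => deriv f x ^ 2) y ∂μ
        + Ent μ (gaussianAverage σ (fun x => f x ^ 2)) := by
  have hfc := hf.continuous
  have hdc : Continuous (deriv f) := hf.continuous_deriv le_rfl
  obtain ⟨A, hA⟩ := exists_abs_le_of_hasCompactSupport hfc hc
  obtain ⟨B, hB⟩ := exists_sq_le_of_hasCompactSupport hfc hc
  obtain ⟨D, hD⟩ := exists_sq_le_of_hasCompactSupport hdc hc.deriv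
  set g := gaussianAverage σ (fun x => f x ^ 2) with hg
  have hgpos : ∀ y, 0 < g y := gaussianAverage_sq_pos hσ hfc hB h0
  have hgc : Continuous g := continuous_gaussianAverage (hfc.pow 2) hB
  have hgi : Integrable g μ := integrable_gaussianAverage (hfc.pow 2) hB
  have hmpos : 0 < m := by
    rw [hm]
    refine (integral_pos_iff_support_of_nonneg (fun y => (hgpos y).le) hgi).2 ?_
    have : Function.support g = Set.univ := Set.eq_univ_of_forall fun y => (hgpos y).ne'
    simp [this]
  have hψc : Continuous fun x => f x ^ 2 * log (f x ^ 2 / m) :=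
    (continuous_mul_log_div m).comp (hfc.pow 2)
  obtain ⟨C, hC⟩ := exists_abs_le_of_hasCompactSupport hψc
    (hc.mono fun x hx hfx => hx (by simp [hfx]))
  have hglog : Integrable (fun y => g y * log (g y / m)) μ :=
    integrable_continuous_comp hgc.aestronglyMeasurable (abs_gaussianAverage_le hB)
      (continuous_mul_log_div m)
  have hDi : Integrable (gaussianAverage σ (fun x => deriv f x ^ 2)) μ :=
    integrable_gaussianAverage (hdc.pow 2) hD
  have hfibre (y : ℝ) : gaussianAverage σ (fun x => f x ^ 2 * log (f x ^ 2 / m)) y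
      ≤ 2163 * σ ^ 2 * gaussianAverage σ (fun x => deriv f x ^ 2) y
        + g y * log (g y / m) := by
    let u : ℝ → ℝ := fun z => f (y + σ * z)
    have hu : ContDiff ℝ 1 u := hf.comp (by fun_prop)
    have huc : HasCompactSupport u :=
      hc.comp_homeomorph ((Homeomorph.mulLeft₀ σ hσ.ne').trans (Homeomorph.addLeft y))
    have hdu (z : ℝ) : deriv u z = σ * deriv f (y + σ * z) := by
      have h1 : HasDerivAt (fun z => y + σ * z) σ z :=
        (((hasDerivAt_id z).const_mul σ).const_add y).congr_deriv (by simp)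
      have h2 := (((hf.differentiable one_ne_zero) (y + σ * z)).hasDerivAt).comp z h1
      exact h2.deriv.trans (mul_comm _ _)
    have hlsi := gaussian_lsi hu huc
    have hE : ∫ z, deriv u z ^ 2 ∂(gaussianReal 0 1)
        = σ ^ 2 * gaussianAverage σ (fun x => deriv f x ^ 2) y := by
      simp_rw [hdu, mul_pow]
      rw [integral_const_mul]; rfl
    have hent : gaussianAverage σ (fun x => f x ^ 2 * log (f x ^ 2 / m)) y
        = Ent (gaussianReal 0 1) (fun z => u z ^ 2) + g y * log (g y / m) := by
      have hsplit (z : ℝ) : u z ^ 2 * log (u z ^ 2 / m)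
          = u z ^ 2 * log (u z ^ 2 / g y) + u z ^ 2 * log (g y / m) := by
        rcases eq_or_ne (u z ^ 2) 0 with h | h
        · simp [h]
        · rw [log_div h hmpos.ne', log_div h (hgpos y).ne',
            log_div (hgpos y).ne' hmpos.ne']; ring
      have i1 : Integrable (fun z => u z ^ 2 * log (u z ^ 2 / g y)) (gaussianReal 0 1) :=
        integrable_continuous_comp hu.continuous.aestronglyMeasurable (fun z => hA _)
          ((continuous_mul_log_div (g y)).comp (continuous_pow 2))
      have i2 : Integrable (fun z => u z ^ 2) (gaussianReal 0 1) :=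
        integrable_comp_gaussian (hfc.pow 2) hB y
      change ∫ z, u z ^ 2 * log (u z ^ 2 / m) ∂(gaussianReal 0 1) = _
      simp_rw [hsplit]
      rw [integral_add i1 (i2.mul_const _), integral_mul_const]
      rfl
    rw [hent]
    rw [hE] at hlsi
    linarith
  refine (integral_mono (integrable_gaussianAverage hψc hC)
    ((hDi.const_mul _).add hglog) hfibre).trans_eq ?_
  rw [Ent, ← hm, ← integral_const_mul]
  exact integral_add (hDi.const_mul _) hglog

lemma Ent_gaussianAverage_le {R a : ℝ} (hR : 0 < R) (ha : 0 < a) {μ : Measure ℝ}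
    [IsProbabilityMeasure μ] (hsupp : μ (Set.Icc (-R) R)ᶜ = 0)
    (hdens : ∀ A : Set ℝ, MeasurableSet A →
      ENNReal.ofReal a * volume (A ∩ Set.Icc (-R) R) ≤ μ A)
    {σ : ℝ} (hσ : 0 < σ) {f : ℝ → ℝ} (hf : ContDiff ℝ 1 f) (hc : HasCompactSupport f)
    {x₀ : ℝ} (h0 : f x₀ ≠ 0) :
    Ent μ (gaussianAverage σ (fun x => f x ^ 2))
      ≤ 52 * (R / a) * ∫ t, gaussianAverage σ (fun x => deriv f x ^ 2) t ∂μ := by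
  have hfc := hf.continuous
  obtain ⟨B, hB⟩ := exists_sq_le_of_hasCompactSupport hfc hc
  have hosc := fun x (hx : x ∈ Set.Icc (-R) R) => sq_sqrt_gaussianAverage_sub_le hR ha hdens hσ
    hf hc h0 hx (y := 0) (by constructor <;> linarith)
  set g := gaussianAverage σ (fun x => f x ^ 2) with hg
  set E := ∫ t, gaussianAverage σ (fun x => deriv f x ^ 2) t ∂μ with hE
  have hE0 : 0 ≤ E := integral_nonneg fun t => integral_nonneg fun z => sq_nonneg _
  have hg0 : ∀ y, 0 ≤ g y := fun y => integral_nonneg fun z => sq_nonneg _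
  have hgc : Continuous g := continuous_gaussianAverage (hfc.pow 2) hB
  have hmeas : AEStronglyMeasurable (fun y => √(g y)) μ := hgc.sqrt.aestronglyMeasurable
  have hbd : ∀ y, |√(g y)| ≤ √B := fun y => by
    rw [abs_of_nonneg (sqrt_nonneg _)]
    exact sqrt_le_sqrt ((le_abs_self _).trans (abs_gaussianAverage_le hB y))
  have hint : Integrable (fun y => (√(g y) - √(g 0)) ^ 2) μ :=
    integrable_continuous_comp hmeas hbd (φ := fun r => (r - √(g 0)) ^ 2) (by fun_prop)
  refine le_of_forall_pos_le_add fun ε hε => ?_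
  set s := 2 * (R / a) * E + ε / 26 with hs
  have hspos : 0 < s := by positivity
  have hae : ∀ᵐ y ∂μ, (√(g y) - √(g 0)) ^ 2 ≤ s := by
    filter_upwards [mem_ae_iff.2 hsupp] with y hy
    have := hosc y hy
    linarith
  have hexp : (4 : ℝ) ≤ exp 2 := by
    have e : exp 2 = exp 1 ^ 2 := by rw [← exp_nat_mul]; norm_num
    rw [e]; nlinarith [exp_one_gt_d9]
  have h := Ent_sq_le_of_osc hmeas hbd (√(g 0)) hspos (L := fun _ => 2) (fun _ => by norm_num)
    (by
      filter_upwards [hae] with y hy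
      nlinarith) (hint.mul_const 2)
  have hle : ∫ y, (√(g y) - √(g 0)) ^ 2 ∂μ ≤ s := by
    have := integral_mono_ae hint (integrable_const s) hae
    simpa using this
  simp_rw [sq_sqrt (hg0 _)] at h
  rw [integral_mul_const] at h
  change Ent μ g ≤ _ at h
  linarith

theorem stmt16 (R a : ℝ) (hR : 0 < R) (ha : 0 < a)
    (μ : Measure ℝ) [IsProbabilityMeasure μ]
    (hsupp : μ (Set.Icc (-R) R)ᶜ = 0)
    (hdens : ∀ A : Set ℝ, MeasurableSet A →
      ENNReal.ofReal a * volume (A ∩ Set.Icc (-R) R) ≤ μ A)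
    (δ : ℝ) (hδpos : 0 < δ) (hδ : δ ≤ R ^ 2) :
    SatisfiesLSI (mconv μ (gaussianMeasure δ))
      (2067 * (R / a) + 9016 * δ + 1248 * δ * Real.log (1 / (a ^ 2 * δ))) := by
  intro f hf' hc
  by_cases hf0 : ∀ x, f x = 0
  · have : f = fun _ => 0 := funext hf0
    simp [this, Ent]
  obtain ⟨x₀, h0⟩ := not_forall.1 hf0
  have hf : ContDiff ℝ 1 f := hf'.of_le (by exact_mod_cast le_top)
  have hfc := hf.continuous
  have hdc : Continuous (deriv f) := hf.continuous_deriv le_rfl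
  obtain ⟨B, hB⟩ := exists_sq_le_of_hasCompactSupport hfc hc
  obtain ⟨D, hD⟩ := exists_sq_le_of_hasCompactSupport hdc hc.deriv
  have hσ : 0 < √δ := sqrt_pos.2 hδpos
  have hm := integral_mconv_gaussianMeasure (μ := μ) (Φ := fun x => f x ^ 2) hδpos
    (hfc.pow 2) hB
  have hψc : Continuous fun x =>
      f x ^ 2 * log (f x ^ 2 / ∫ t, f t ^ 2 ∂(mconv μ (gaussianMeasure δ))) :=
    (continuous_mul_log_div _).comp (hfc.pow 2)
  obtain ⟨C, hC⟩ := exists_abs_le_of_hasCompactSupport hψc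
    (hc.mono fun x hx hfx => hx (by simp [hfx]))
  rw [Ent, integral_mconv_gaussianMeasure hδpos hψc hC,
    integral_mconv_gaussianMeasure (Φ := fun x => deriv f x ^ 2) hδpos (hdc.pow 2) hD]
  have h1 := integral_gaussianAverage_entropy_le hσ hf hc h0 hm
  have h2 := Ent_gaussianAverage_le hR ha hsupp hdens hσ hf hc h0
  have hE0 : 0 ≤ ∫ y, gaussianAverage (√δ) (fun x => deriv f x ^ 2) y ∂μ :=
    integral_nonneg fun t => integral_nonneg fun z => sq_nonneg _
  rw [sq_sqrt hδpos.le] at h1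
  have haR : a * (2 * R) ≤ 1 := by
    have h := hdens Set.univ MeasurableSet.univ
    rw [Set.univ_inter, Real.volume_Icc, measure_univ, ← ENNReal.ofReal_mul ha.le,
      ENNReal.ofReal_le_one] at h
    linarith
  have hlog : 0 ≤ log (1 / (a ^ 2 * δ)) := by
    refine log_nonneg ((one_le_div (by positivity)).2 ?_)
    calc a ^ 2 * δ ≤ a ^ 2 * R ^ 2 := by gcongr
      _ = (a * R) ^ 2 := by ring
      _ ≤ 1 := pow_le_one₀ (by positivity) (by nlinarith [mul_pos ha hR])
  have hRa : 0 < R / a := by positivity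
  have hlog' : 0 ≤ δ * log (1 / (a ^ 2 * δ)) := by positivity
  refine (h1.trans (add_le_add_right h2 _)).trans ?_
  rw [← add_mul]
  exact mul_le_mul_of_nonneg_right (by linarith) hE0
end

section
/- Let n ≥ 1, R > 0, let μ = (1/2) δ_{(R,0,…,0)} + (1/2) δ_{(−R,0,…,0)} on ℝⁿ, let 0 < δ ≤ R², and let μ_δ = μ * γ_δ. Let f : ℝⁿ → ℝ be the Lipschitz function f(x) = min(max((R/δ) x₁, 0), 1). Then Ent_{μ_δ}(f²) ≥ (1/11) · (δ^{3/2}/R) · exp(R²/(2δ)) · (R/δ)² · μ_δ({x ∈ ℝⁿ : 0 ≤ x₁ ≤ δ/R}), where (R/δ)² · μ_δ({0 ≤ x₁ ≤ δ/R}) equals the energy ∫ |∇f|² dμ_δ (the gradient of f existing μ_δ-almost everywhere and satisfying |∇f| = (R/δ) · 1_{{0 < x₁ < δ/R}}). Consequently, any constant c for which μ_δ satisfies a logarithmic Sobolev inequality valid for all Lipschitz functions must satisfy c ≥ (1/11) · (δ^{3/2}/R) · exp(R²/(2δ)). -/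
open MeasureTheory Real ENNReal

/-- The symmetric two-point measure μ = (1/2)δ_{(R,0,…,0)} + (1/2)δ_{(−R,0,…,0)} on ℝⁿ. -/
noncomputable def twoPointMeas (n : ℕ) (hn : 1 ≤ n) (R : ℝ) :
    Measure (EuclideanSpace ℝ (Fin n)) :=
  ((1 : ℝ≥0∞) / 2) • Measure.dirac (EuclideanSpace.single ⟨0, hn⟩ R) +
    ((1 : ℝ≥0∞) / 2) • Measure.dirac (EuclideanSpace.single ⟨0, hn⟩ (-R))

open ProbabilityTheory in
/-- The measure `gaussianRn n δ` is the product of `n` centered one-dimensional Gaussians. -/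
lemma gaussianRn_map_ofLp (n : ℕ) {δ : ℝ} (hδ : 0 < δ) :
    (gaussianRn n δ).map (WithLp.ofLp : EuclideanSpace ℝ (Fin n) → Fin n → ℝ) =
      Measure.pi fun _ => gaussianReal 0 δ.toNNReal := by
  have hv : δ.toNNReal ≠ 0 := by simpa using hδ
  have hcoe : ((δ.toNNReal : NNReal) : ℝ) = δ := Real.coe_toNNReal δ hδ.le
  have hdens : ∀ x : EuclideanSpace ℝ (Fin n),
      (2 * π * δ) ^ (-(n : ℝ) / 2) * Real.exp (-‖x‖ ^ 2 / (2 * δ)) =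
        ∏ i, gaussianPDFReal 0 δ.toNNReal (x.ofLp i) := by
    intro x
    have hpos : 0 < 2 * π * δ := by positivity
    simp only [gaussianPDFReal, hcoe, sub_zero]
    rw [Finset.prod_mul_distrib, ← Real.exp_sum, Finset.prod_const, Finset.card_univ,
      Fintype.card_fin, EuclideanSpace.real_norm_sq_eq, ← Finset.sum_div, Finset.sum_neg_distrib,
      Real.sqrt_eq_rpow, ← Real.rpow_neg hpos.le, ← Real.rpow_natCast, ← Real.rpow_mul hpos.le]
    congr 2
    ring
  symm
  refine Measure.pi_eq fun s hs => ?_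
  have hms : MeasurableSet (Set.univ.pi s) := MeasurableSet.univ_pi hs
  have hint : ∀ i, Integrable (gaussianPDFReal 0 δ.toNNReal)
      ((volume : Measure ℝ).restrict (s i)) :=
    fun i => (integrable_gaussianPDFReal 0 δ.toNNReal).restrict
  have hmeas : Measurable fun y : Fin n → ℝ =>
      ENNReal.ofReal (∏ i, gaussianPDFReal 0 δ.toNNReal (y i)) := by
    refine (Finset.measurable_fun_prod _ fun i _ => ?_).ennreal_ofReal
    exact (measurable_gaussianPDFReal 0 δ.toNNReal).comp (measurable_pi_apply i)
  rw [Measure.map_apply (WithLp.measurable_ofLp 2 _) hms, gaussianRn,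
    withDensity_apply _ (WithLp.measurable_ofLp 2 _ hms)]
  simp_rw [hdens]
  rw [(PiLp.volume_preserving_ofLp (Fin n)).setLIntegral_comp_preimage hms hmeas, volume_pi,
    Measure.restrict_pi_pi, ← ofReal_integral_eq_lintegral_ofReal,
    integral_fintype_prod_eq_prod (fun _ => gaussianPDFReal 0 δ.toNNReal),
    ENNReal.ofReal_prod_of_nonneg]
  · exact Finset.prod_congr rfl fun i _ => (gaussianReal_apply_eq_integral 0 hv (s i)).symm
  · exact fun i _ => integral_nonneg fun x => gaussianPDFReal_nonneg _ _ _
  · exact Integrable.fintype_prod hint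
  · exact ae_of_all _ fun y => Finset.prod_nonneg fun i _ => gaussianPDFReal_nonneg _ _ _

open ProbabilityTheory in
lemma gaussianRn_map_apply (n : ℕ) {δ : ℝ} (hδ : 0 < δ) (i : Fin n) :
    (gaussianRn n δ).map (fun x => x i) = gaussianReal 0 δ.toNNReal := by
  have h := congrArg (Measure.map (fun y : Fin n → ℝ => y i)) (gaussianRn_map_ofLp n hδ)
  rw [Measure.map_map (measurable_pi_apply i) (WithLp.measurable_ofLp 2 _),
    (measurePreserving_eval (fun _ : Fin n => gaussianReal 0 δ.toNNReal) i).map_eq] at h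
  exact h

open ProbabilityTheory in
/-- The first marginal of the smoothed two-point measure is a mixture of two Gaussians. -/
lemma mconvn_twoPointMeas_gaussianRn_map (n : ℕ) (hn : 1 ≤ n) (R : ℝ) {δ : ℝ} (hδ : 0 < δ) :
    (mconvn (twoPointMeas n hn R) (gaussianRn n δ)).map (fun x => x ⟨0, hn⟩) =
      ((1 : ℝ≥0∞) / 2) • gaussianReal R δ.toNNReal +
        ((1 : ℝ≥0∞) / 2) • gaussianReal (-R) δ.toNNReal := by
  have : SFinite (gaussianRn n δ) := by unfold gaussianRn; infer_instance
  have hev : Measurable fun x : EuclideanSpace ℝ (Fin n) => x ⟨0, hn⟩ := by fun_prop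
  have hadd : Measurable fun p : EuclideanSpace ℝ (Fin n) × EuclideanSpace ℝ (Fin n) =>
    p.1 + p.2 := by fun_prop
  have key : ∀ a : ℝ, ((gaussianRn n δ).map (Prod.mk (EuclideanSpace.single ⟨0, hn⟩ a))).map
      ((fun x : EuclideanSpace ℝ (Fin n) => x ⟨0, hn⟩) ∘ fun p => p.1 + p.2) =
        gaussianReal a δ.toNNReal := by
    intro a
    have h := gaussianReal_map_const_add (μ := 0) (v := δ.toNNReal) a
    rw [← gaussianRn_map_apply n hδ ⟨0, hn⟩, Measure.map_map (by fun_prop) hev, zero_add] at h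
    rw [Measure.map_map (hev.comp hadd) (by fun_prop), ← h]
    congr 1
  rw [mconvn, Measure.map_map hev hadd, twoPointMeas, Measure.add_prod, Measure.prod_smul_left,
    Measure.prod_smul_left, Measure.dirac_prod, Measure.dirac_prod,
    Measure.map_add _ _ (hev.comp hadd), Measure.map_smul, Measure.map_smul, key, key]

open ProbabilityTheory in
lemma gaussianReal_neg_apply (m : ℝ) (v : NNReal) {s : Set ℝ} (hs : MeasurableSet s) :
    gaussianReal (-m) v s = gaussianReal m v (Neg.neg ⁻¹' s) := by
  rw [← gaussianReal_map_neg, Measure.map_apply measurable_neg hs]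

open ProbabilityTheory in
lemma half_le_gaussianReal_real_Ici (m : ℝ) (v : NNReal) :
    1 / 2 ≤ (gaussianReal m v).real (Set.Ici m) := by
  have hsymm : (gaussianReal m v).real (Set.Iic m) = (gaussianReal m v).real (Set.Ici m) := by
    have h : (gaussianReal m v).map (fun x => 2 * m - x) = gaussianReal m v := by
      rw [gaussianReal_map_const_sub]
      congr 1
      ring
    rw [measureReal_def, measureReal_def]
    conv_rhs => rw [← h, Measure.map_apply (by fun_prop) measurableSet_Ici]
    congr 2
    ext x
    simp only [Set.mem_Iic, Set.mem_preimage, Set.mem_Ici]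
    constructor <;> intro <;> linarith
  have hunion : (1 : ℝ) ≤
      (gaussianReal m v).real (Set.Iic m) + (gaussianReal m v).real (Set.Ici m) := by
    have := measureReal_union_le (μ := gaussianReal m v) (Set.Iic m) (Set.Ici m)
    rwa [Set.Iic_union_Ici, probReal_univ] at this
  linarith

open ProbabilityTheory in
lemma gaussianReal_real_Icc_le {m v a b C : ℝ} (hv : 0 < v) (hab : a ≤ b)
    (hC : ∀ x ∈ Set.Icc a b, -(x - m) ^ 2 / (2 * v) ≤ C) :
    (gaussianReal m v.toNNReal).real (Set.Icc a b) ≤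
      (b - a) * ((√(2 * π * v))⁻¹ * Real.exp C) := by
  have hv' : v.toNNReal ≠ 0 := by simpa using hv
  have hcoe : ((v.toNNReal : NNReal) : ℝ) = v := Real.coe_toNNReal v hv.le
  rw [measureReal_def, gaussianReal_apply_eq_integral _ hv', ENNReal.toReal_ofReal
    (integral_nonneg fun x => gaussianPDFReal_nonneg _ _ _)]
  calc ∫ x in Set.Icc a b, gaussianPDFReal m v.toNNReal x
      ≤ ∫ _ in Set.Icc a b, (√(2 * π * v))⁻¹ * Real.exp C := by
        refine setIntegral_mono_on (integrable_gaussianPDFReal _ _).integrableOn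
          (integrableOn_const (by simp)) measurableSet_Icc fun x hx => ?_
        rw [gaussianPDFReal, hcoe]
        gcongr
        exact hC x hx
    _ = (b - a) * ((√(2 * π * v))⁻¹ * Real.exp C) := by
        rw [setIntegral_const, Real.volume_real_Icc_of_le hab, smul_eq_mul]

/-- A function with values in `[0, 1]` whose support has mass at most `1/2` has entropy at least
`log 2` times its mean. -/
lemma integral_mul_log_two_le_Ent {α : Type*} [MeasurableSpace α] (ν : Measure α)
    [IsProbabilityMeasure ν] {g : α → ℝ} (hg : Measurable g) (h0 : ∀ x, 0 ≤ g x)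
    (h1 : ∀ x, g x ≤ 1) (hsupp : ν.real {x | 0 < g x} ≤ 1 / 2) (hpos : 0 < ∫ x, g x ∂ν) :
    (∫ x, g x ∂ν) * Real.log 2 ≤ Ent ν g := by
  set m := ∫ x, g x ∂ν with hm
  have hS : MeasurableSet {x | 0 < g x} := measurableSet_lt measurable_const hg
  have hgi : Integrable g ν := Integrable.of_bound hg.aestronglyMeasurable 1
    (ae_of_all _ fun x => by rw [Real.norm_of_nonneg (h0 x)]; exact h1 x)
  have hind : Integrable (Set.indicator {x | 0 < g x} fun _ => 2 * m) ν :=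
    (integrable_const _).indicator hS
  have hEnt : Integrable (fun x => g x * Real.log (g x / m)) ν := by
    have hlog : Integrable (fun x => g x * Real.log (g x)) ν := by
      refine Integrable.of_bound (hg.mul (Real.measurable_log.comp hg)).aestronglyMeasurable 1
        (ae_of_all _ fun x => ?_)
      rcases (h0 x).eq_or_lt with h | h
      · simp [← h]
      · rw [Real.norm_eq_abs, mul_comm]
        exact (Real.abs_log_mul_self_lt _ h (h1 x)).le
    refine (hlog.sub (hgi.mul_const (Real.log m))).congr (ae_of_all _ fun x => ?_)
    rcases (h0 x).eq_or_lt with h | h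
    · simp [← h]
    · simp only [Pi.sub_apply]
      rw [Real.log_div h.ne' hpos.ne']
      ring
  have hpt : ∀ x, g x * Real.log 2 + (g x - Set.indicator {x | 0 < g x} (fun _ => 2 * m) x) ≤
      g x * Real.log (g x / m) := by
    intro x
    rcases (h0 x).eq_or_lt with h | h
    · simp [← h]
    · rw [Set.indicator_of_mem (show x ∈ {x | 0 < g x} from h)]
      have hlog := Real.one_sub_inv_le_log_of_pos (show 0 < g x / (2 * m) by positivity)
      have hsplit : Real.log (g x / m) = Real.log 2 + Real.log (g x / (2 * m)) := by
        rw [← Real.log_mul (by norm_num) (by positivity)]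
        congr 1
        field_simp
      have hmul := mul_le_mul_of_nonneg_left hlog h.le
      have hcancel : g x * (1 - (g x / (2 * m))⁻¹) = g x - 2 * m := by
        field_simp
      rw [hsplit]
      linarith
  have hsub : Integrable (fun x => g x - Set.indicator {x | 0 < g x} (fun _ => 2 * m) x) ν :=
    hgi.sub hind
  have hmono := integral_mono ((hgi.mul_const (Real.log 2)).add hsub) hEnt hpt
  have hval : ∫ x, g x * Real.log 2 +
      (g x - Set.indicator {x | 0 < g x} (fun _ => 2 * m) x) ∂ν =
        m * Real.log 2 + (m - ν.real {x | 0 < g x} * (2 * m)) := by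
    rw [integral_add (hgi.mul_const _) hsub, integral_sub hgi hind,
      integral_mul_const, integral_indicator_const _ hS, smul_eq_mul]
  have hle : ν.real {x | 0 < g x} * (2 * m) ≤ 1 / 2 * (2 * m) := by gcongr
  have hmono' : m * Real.log 2 + (m - ν.real {x | 0 < g x} * (2 * m)) ≤ Ent ν g := by
    rw [← hval]
    exact hmono
  linarith

/-- The truncated linear function `x ↦ min (max (k * x i) 0) 1` is Lipschitz. -/
lemma lipschitzWith_truncated_coord {n : ℕ} (i : Fin n) (k : ℝ) :
    ∃ L : NNReal, LipschitzWith L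
      fun x : EuclideanSpace ℝ (Fin n) => min (max (k * x i) 0) 1 := by
  have h := (k • (EuclideanSpace.proj i : EuclideanSpace ℝ (Fin n) →L[ℝ] ℝ)).lipschitz
  exact ⟨_, (h.max_const 0).min_const 1⟩

/-- Off the two corners, the gradient of a truncated linear function of one coordinate has
squared norm `k ^ 2` in the strip where the function is linear and `0` elsewhere. -/
lemma norm_gradient_truncated_coord_sq {n : ℕ} (i : Fin n) {k : ℝ} (hk : 0 < k)
    (x : EuclideanSpace ℝ (Fin n)) (hx0 : x i ≠ 0) (hx1 : x i ≠ k⁻¹) :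
    ‖gradient (fun y : EuclideanSpace ℝ (Fin n) => min (max (k * y i) 0) 1) x‖ ^ 2 =
      Set.indicator {y : EuclideanSpace ℝ (Fin n) | 0 ≤ y i ∧ y i ≤ k⁻¹} (fun _ => k ^ 2) x := by
  have hcont : Continuous fun y : EuclideanSpace ℝ (Fin n) => y i := by fun_prop
  have hk1 : k * k⁻¹ = 1 := mul_inv_cancel₀ hk.ne'
  rcases lt_or_gt_of_ne hx0 with h | h
  · have heq : (fun y : EuclideanSpace ℝ (Fin n) => min (max (k * y i) 0) 1) =ᶠ[nhds x]
        fun _ => 0 := by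
      filter_upwards [hcont.continuousAt.eventually_lt continuousAt_const h] with y hy
      rw [max_eq_right (by nlinarith), min_eq_left zero_le_one]
    rw [heq.gradient_eq, gradient_fun_const, Set.indicator_of_notMem (fun hx => h.not_ge hx.1)]
    simp
  rcases lt_or_gt_of_ne hx1 with h' | h'
  · have heq : (fun y : EuclideanSpace ℝ (Fin n) => min (max (k * y i) 0) 1) =ᶠ[nhds x]
        fun y => inner ℝ (EuclideanSpace.single i k) y := by
      filter_upwards [continuousAt_const.eventually_lt hcont.continuousAt h,
        hcont.continuousAt.eventually_lt continuousAt_const h'] with y hy hy'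
      rw [max_eq_left (by positivity), min_eq_left (by nlinarith)]
      rw [EuclideanSpace.inner_single_left, conj_trivial]
    have hgrad : HasGradientAt (fun y => inner ℝ (EuclideanSpace.single i k) y)
        (EuclideanSpace.single i k : EuclideanSpace ℝ (Fin n)) x := by
      rw [hasGradientAt_iff_hasFDerivAt]
      exact (InnerProductSpace.toDual ℝ _ _).hasFDerivAt
    rw [heq.gradient_eq, hgrad.gradient, Set.indicator_of_mem
      (show x ∈ {y : EuclideanSpace ℝ (Fin n) | 0 ≤ y i ∧ y i ≤ k⁻¹} from ⟨h.le, h'.le⟩)]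
    simp
  · have heq : (fun y : EuclideanSpace ℝ (Fin n) => min (max (k * y i) 0) 1) =ᶠ[nhds x]
        fun _ => 1 := by
      filter_upwards [continuousAt_const.eventually_lt hcont.continuousAt h'] with y hy
      have : 1 ≤ k * y i := by nlinarith
      rw [min_eq_right (le_max_of_le_left this)]
    rw [heq.gradient_eq, gradient_fun_const, Set.indicator_of_notMem (fun hx => h'.not_ge hx.2)]
    simp

open ProbabilityTheory in
theorem stmt19 (n : ℕ) (hn : 1 ≤ n) (R δ : ℝ) (hR : 0 < R) (hδpos : 0 < δ) (hδ : δ ≤ R ^ 2) :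
    -- entropy lower bound for f(x) = min(max((R/δ)x₁, 0), 1):
    -- Ent_{μ_δ}(f²) ≥ (1/11)(δ^{3/2}/R)exp(R²/(2δ)) · (R/δ)² · μ_δ({0 ≤ x₁ ≤ δ/R}),
    -- the last two factors being the energy ∫|∇f|² dμ_δ
    (1 / 11 * (δ ^ ((3 : ℝ) / 2) / R) * Real.exp (R ^ 2 / (2 * δ)) *
        ((R / δ) ^ 2 *
          ((mconvn (twoPointMeas n hn R) (gaussianRn n δ))
            {x | 0 ≤ x ⟨0, hn⟩ ∧ x ⟨0, hn⟩ ≤ δ / R}).toReal) ≤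
      Ent (mconvn (twoPointMeas n hn R) (gaussianRn n δ))
        (fun x => (min (max (R / δ * x ⟨0, hn⟩) 0) 1) ^ 2)) ∧
    -- consequently, any LSI constant valid for all Lipschitz functions is at least
    -- (1/11)(δ^{3/2}/R)exp(R²/(2δ))
    (∀ c : ℝ,
      (∀ g : EuclideanSpace ℝ (Fin n) → ℝ, (∃ L : NNReal, LipschitzWith L g) →
        Ent (mconvn (twoPointMeas n hn R) (gaussianRn n δ)) (fun x => g x ^ 2) ≤
          c * ∫ x, ‖gradient g x‖ ^ 2 ∂(mconvn (twoPointMeas n hn R) (gaussianRn n δ))) →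
      1 / 11 * (δ ^ ((3 : ℝ) / 2) / R) * Real.exp (R ^ 2 / (2 * δ)) ≤ c) := by
  set ν := mconvn (twoPointMeas n hn R) (gaussianRn n δ) with hν
  have hv : δ.toNNReal ≠ 0 := by simpa using hδpos
  have hk : 0 < R / δ := by positivity
  have hev : Measurable fun x : EuclideanSpace ℝ (Fin n) => x ⟨0, hn⟩ := by fun_prop
  have hmap := mconvn_twoPointMeas_gaussianRn_map n hn R hδpos
  rw [← hν] at hmap
  have hmeas : ∀ s : Set ℝ, MeasurableSet s → ν.real ((fun x => x ⟨0, hn⟩) ⁻¹' s) =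
      1 / 2 * (gaussianReal R δ.toNNReal).real s +
        1 / 2 * (gaussianReal (-R) δ.toNNReal).real s := by
    intro s hs
    rw [measureReal_def, ← Measure.map_apply hev hs, hmap, Measure.add_apply, Measure.smul_apply,
      Measure.smul_apply, smul_eq_mul, smul_eq_mul, ENNReal.toReal_add (by finiteness)
      (by finiteness), ENNReal.toReal_mul, ENNReal.toReal_mul]
    simp [measureReal_def]
  have hprob : IsProbabilityMeasure ν := by
    have h := hmeas Set.univ MeasurableSet.univ
    rw [Set.preimage_univ, probReal_univ (μ := gaussianReal R _),
      probReal_univ (μ := gaussianReal (-R) _)] at h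
    refine ⟨(ENNReal.toReal_eq_one_iff _).1 ?_⟩
    rw [← measureReal_def, h]
    norm_num
  set f : EuclideanSpace ℝ (Fin n) → ℝ := fun x => min (max (R / δ * x ⟨0, hn⟩) 0) 1 with hf
  have hfm : Measurable f := by fun_prop
  have hf0 : ∀ x, 0 ≤ f x := fun x => le_min (le_max_right _ _) zero_le_one
  have hf1 : ∀ x, f x ≤ 1 := fun x => min_le_right _ _
  have hsupp : ν.real {x | 0 < f x ^ 2} ≤ 1 / 2 := by
    have hset : {x | 0 < f x ^ 2} = (fun x => x ⟨0, hn⟩) ⁻¹' Set.Ioi 0 := by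
      ext x
      simp only [Set.mem_ofPred_eq, Set.mem_preimage, Set.mem_Ioi]
      constructor
      · intro h
        by_contra! hx
        have : f x = 0 := by
          simp only [hf]
          rw [max_eq_right (by nlinarith), min_eq_left zero_le_one]
        simp [this] at h
      · intro h
        have : 0 < f x := lt_min (lt_max_of_lt_left (by positivity)) one_pos
        positivity
    have hdisj := measureReal_union (μ := gaussianReal R δ.toNNReal)
      (s₁ := Set.Iio 0) (s₂ := Set.Ioi 0)
      (Set.Iio_disjoint_Ioi_of_le le_rfl) measurableSet_Ioi
    have hle : (gaussianReal R δ.toNNReal).real (Set.Iio 0 ∪ Set.Ioi 0) ≤ 1 := measureReal_le_one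
    have hneg : (gaussianReal (-R) δ.toNNReal).real (Set.Ioi 0) =
        (gaussianReal R δ.toNNReal).real (Set.Iio 0) := by
      rw [measureReal_def, gaussianReal_neg_apply _ _ measurableSet_Ioi, measureReal_def]
      simp
    rw [hset, hmeas _ measurableSet_Ioi, hneg]
    linarith
  have hmean : 1 / 4 ≤ ∫ x, f x ^ 2 ∂ν := by
    have hmS : MeasurableSet ((fun x : EuclideanSpace ℝ (Fin n) => x ⟨0, hn⟩) ⁻¹' Set.Ici R) :=
      hev measurableSet_Ici
    have hlow : 1 / 4 ≤ ν.real ((fun x => x ⟨0, hn⟩) ⁻¹' Set.Ici R) := by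
      rw [hmeas _ measurableSet_Ici]
      have h1 := half_le_gaussianReal_real_Ici R δ.toNNReal
      have h2 : 0 ≤ (gaussianReal (-R) δ.toNNReal).real (Set.Ici R) := measureReal_nonneg
      linarith
    refine hlow.trans ?_
    rw [← integral_indicator_one hmS]
    refine integral_mono ((integrable_const _).indicator hmS)
      (Integrable.of_bound (hfm.pow_const 2).aestronglyMeasurable 1 (ae_of_all _ fun x => ?_))
      fun x => Set.indicator_apply_le' (fun hx => ?_) fun _ => sq_nonneg _
    · rw [Real.norm_of_nonneg (sq_nonneg _)]
      exact pow_le_one₀ (hf0 x) (hf1 x)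
    · have hx' : R ≤ x ⟨0, hn⟩ := hx
      have hge : 1 ≤ R / δ * x ⟨0, hn⟩ := by
        rw [div_mul_eq_mul_div, one_le_div hδpos]
        nlinarith
      have : f x = 1 := min_eq_right (le_max_of_le_left hge)
      simp [this]
  have hEnt : 1 / 4 * Real.log 2 ≤ Ent ν fun x => f x ^ 2 := by
    refine le_trans ?_ (integral_mul_log_two_le_Ent ν (hfm.pow_const 2) (fun x => sq_nonneg _)
      (fun x => pow_le_one₀ (hf0 x) (hf1 x)) hsupp (by linarith))
    gcongr
  have hstrip : ν.real {x | 0 ≤ x ⟨0, hn⟩ ∧ x ⟨0, hn⟩ ≤ δ / R} ≤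
      δ / R * ((√(2 * π * δ))⁻¹ * Real.exp (1 - R ^ 2 / (2 * δ))) := by
    have hab : 0 ≤ δ / R := by positivity
    have h1 := gaussianReal_real_Icc_le (m := R) (C := 1 - R ^ 2 / (2 * δ)) hδpos hab (by
      rintro x ⟨hx0, hx1⟩
      rw [le_div_iff₀ hR] at hx1
      rw [one_sub_div (by positivity)]
      gcongr
      nlinarith)
    have h2 := gaussianReal_real_Icc_le (m := -R) (C := 1 - R ^ 2 / (2 * δ)) hδpos hab (by
      rintro x ⟨hx0, hx1⟩
      rw [one_sub_div (by positivity)]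
      gcongr
      nlinarith)
    have h3 := hmeas (Set.Icc 0 (δ / R)) measurableSet_Icc
    rw [sub_zero] at h1 h2
    change ν.real ((fun x => x ⟨0, hn⟩) ⁻¹' Set.Icc 0 (δ / R)) ≤ _
    linarith
  set K := 1 / 11 * (δ ^ ((3 : ℝ) / 2) / R) * Real.exp (R ^ 2 / (2 * δ)) with hK
  set E := (R / δ) ^ 2 * (ν {x | 0 ≤ x ⟨0, hn⟩ ∧ x ⟨0, hn⟩ ≤ δ / R}).toReal with hE
  have hE0 : 0 ≤ E := by positivity
  have hconst : K * E ≤ 1 / 4 * Real.log 2 := by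
    have hs2 : 2 ≤ √(2 * π) := Real.le_sqrt_of_sq_le (by nlinarith [Real.pi_gt_three])
    have hpow : δ ^ ((3 : ℝ) / 2) = δ * √δ := by
      rw [Real.sqrt_eq_rpow, ← Real.rpow_one_add' hδpos.le (by norm_num)]
      norm_num
    have hsδ : 0 < √δ := Real.sqrt_pos.2 hδpos
    have hexp : Real.exp (1 - R ^ 2 / (2 * δ)) = Real.exp 1 / Real.exp (R ^ 2 / (2 * δ)) :=
      Real.exp_sub _ _
    calc K * E ≤ K * ((R / δ) ^ 2 *
          (δ / R * ((√(2 * π * δ))⁻¹ * Real.exp (1 - R ^ 2 / (2 * δ))))) := by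
          rw [hE]
          gcongr
          exact hstrip
      _ = Real.exp 1 / (11 * √(2 * π)) := by
          rw [hK, hpow, hexp, Real.sqrt_mul (by positivity) δ]
          field_simp
      _ ≤ Real.exp 1 / (11 * 2) := by gcongr
      _ ≤ 1 / 4 * Real.log 2 := by
          linarith [Real.exp_one_lt_d9, Real.log_two_gt_d9]
  have hmain : K * E ≤ Ent ν fun x => f x ^ 2 := hconst.trans hEnt
  refine ⟨hmain, fun c hc => ?_⟩
  have henergy : ∫ x, ‖gradient f x‖ ^ 2 ∂ν = E := by
    have hnull : ∀ a : ℝ, ∀ᵐ x ∂ν, x ⟨0, hn⟩ ≠ a := by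
      intro a
      have := nullSingletonClass_gaussianReal (μ := R) hv
      have := nullSingletonClass_gaussianReal (μ := -R) hv
      have h : ν ((fun x => x ⟨0, hn⟩) ⁻¹' {a}) = 0 := by
        rw [← Measure.map_apply hev (measurableSet_singleton a), hmap]
        simp
      refine measure_mono_null (fun x hx => ?_) h
      simpa using hx
    have hmS : MeasurableSet {x : EuclideanSpace ℝ (Fin n) |
        0 ≤ x ⟨0, hn⟩ ∧ x ⟨0, hn⟩ ≤ δ / R} := hev measurableSet_Icc
    have hae : (fun x => ‖gradient f x‖ ^ 2) =ᵐ[ν]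
        Set.indicator {x | 0 ≤ x ⟨0, hn⟩ ∧ x ⟨0, hn⟩ ≤ δ / R} fun _ => (R / δ) ^ 2 := by
      filter_upwards [hnull 0, hnull (δ / R)] with x hx0 hx1
      rw [← inv_div R δ] at hx1 ⊢
      exact norm_gradient_truncated_coord_sq ⟨0, hn⟩ hk x hx0 hx1
    rw [integral_congr_ae hae, integral_indicator_const _ hmS, smul_eq_mul, mul_comm, hE,
      measureReal_def]
  have hlsi := hc f (lipschitzWith_truncated_coord ⟨0, hn⟩ (R / δ))
  rw [henergy] at hlsi
  have hpos : 0 < c * E := by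
    have := Real.log_pos one_lt_two
    linarith
  have hEpos : 0 < E := hE0.lt_of_ne fun h => by simp [← h] at hpos
  exact le_of_mul_le_mul_right (hmain.trans hlsi) hEpos
end
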